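/- Let p ≡ 3 (mod 4) be a prime and let ℓ ≥ 2 be a primitive root modulo p. Write 1/p = Σ_{n≥1} x_n/ℓ^n with digits x_n ∈ {0, 1, ..., ℓ−1} (the purely periodic base-ℓ expansion with period p−1). Then Σ_{n=1}^{p−1} (−1)^n x_n = (ℓ + 1)·h(−p), where h(−p) is the class number of the imaginary quadratic field ℚ(√−p). -/

import Mathlib

theorem summable_digits {ℓ : ℕ} (hℓ : 2 ≤ ℓ) {y : ℕ → ℕ} (hy : ∀ n, y n < ℓ) :
    Summable fun n : ℕ ↦ (y n : ℝ) / (ℓ : ℝ) ^ (n + 1) := by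
  have hℓ' : (2 : ℝ) ≤ ℓ := by exact_mod_cast hℓ
  have hg : Summable fun n : ℕ ↦ ((ℓ : ℝ)⁻¹) ^ n :=
    summable_geometric_of_lt_one (by positivity) (inv_lt_one_of_one_lt₀ (by linarith))
  refine Summable.of_nonneg_of_le (fun n ↦ by positivity) (fun n ↦ ?_) hg
  rw [inv_pow, pow_succ, div_le_iff₀ (by positivity)]
  have : (y n : ℝ) ≤ ℓ := by exact_mod_cast (hy n).le
  field_simp
  exact this

theorem tsum_digits_le_one {ℓ : ℕ} (hℓ : 2 ≤ ℓ) {y : ℕ → ℕ} (hy : ∀ n, y n < ℓ) :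
    ∑' n : ℕ, (y n : ℝ) / (ℓ : ℝ) ^ (n + 1) ≤ 1 := by
  have hℓ' : (2 : ℝ) ≤ ℓ := by exact_mod_cast hℓ
  have hlt : (ℓ : ℝ)⁻¹ < 1 := inv_lt_one_of_one_lt₀ (by linarith)
  have hg := (hasSum_geometric_of_lt_one (r := (ℓ : ℝ)⁻¹) (by positivity) hlt).mul_left
    (((ℓ : ℝ) - 1) * (ℓ : ℝ)⁻¹)
  have h1 : ((ℓ : ℝ) - 1) * (ℓ : ℝ)⁻¹ * (1 - (ℓ : ℝ)⁻¹)⁻¹ = 1 := by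
    have : (ℓ : ℝ) - 1 ≠ 0 := by linarith
    have : (ℓ : ℝ) ≠ 0 := by linarith
    field_simp
  rw [h1] at hg
  refine hasSum_le (fun n ↦ ?_) (summable_digits hℓ hy).hasSum hg
  have : (y n : ℝ) ≤ ℓ - 1 := by
    have : (y n : ℝ) + 1 ≤ ℓ := by exact_mod_cast hy n
    linarith
  rw [inv_pow, pow_succ, div_le_iff₀ (by positivity)]
  field_simp
  exact this

theorem tsum_digits_succ {ℓ : ℕ} (hℓ : 2 ≤ ℓ) {y : ℕ → ℕ} (hy : ∀ n, y n < ℓ) :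
    ℓ * ∑' n : ℕ, (y n : ℝ) / (ℓ : ℝ) ^ (n + 1) =
      y 0 + ∑' n : ℕ, (y (n + 1) : ℝ) / (ℓ : ℝ) ^ (n + 1) := by
  have hℓ' : (ℓ : ℝ) ≠ 0 := by positivity
  rw [(summable_digits hℓ hy).tsum_eq_zero_add, mul_add, ← tsum_mul_left]
  congr 1
  · rw [zero_add, pow_one, mul_div_cancel₀ _ hℓ']
  · refine tsum_congr fun n ↦ ?_
    rw [pow_succ _ (n + 1)]
    field_simp

/-- Long division: the digits of `1 / p` in base `ℓ` are read off the residues of the powers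
of `ℓ` modulo `p`. -/
theorem digit_eq {p : ℕ} [Fact p.Prime] {ℓ : ℕ} (hℓ : 2 ≤ ℓ) (hℓp : (ℓ : ZMod p) ≠ 0)
    {x : ℕ → ℕ} (hdig : ∀ n, x n < ℓ)
    (hexp : (1 : ℝ) / p = ∑' n : ℕ, (x (n + 1) : ℝ) / (ℓ : ℝ) ^ (n + 1)) (k : ℕ) :
    (p : ℤ) * x (k + 1) =
      ℓ * ((ℓ : ZMod p) ^ k).val - ((ℓ : ZMod p) ^ (k + 1)).val := by
  have hp : p.Prime := Fact.out
  have hp0 : (0 : ℝ) < p := by exact_mod_cast hp.pos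
  set T : ℕ → ℝ := fun k ↦ ∑' n : ℕ, (x (n + k + 1) : ℝ) / (ℓ : ℝ) ^ (n + 1) with hT
  have hTs (k : ℕ) : ℓ * T k = x (k + 1) + T (k + 1) := by
    have := tsum_digits_succ hℓ (y := fun n ↦ x (n + k + 1)) (fun n ↦ hdig _)
    simp only [hT]
    rw [this, zero_add]
    congr! 6 with n
    ring
  have hT0 (k : ℕ) : 0 ≤ T k := tsum_nonneg fun n ↦ by positivity
  have hT1 (k : ℕ) : T k ≤ 1 := tsum_digits_le_one hℓ (y := fun n ↦ x (n + k + 1)) (fun n ↦ hdig _)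
  have key (k : ℕ) : p * T k = ((ℓ : ZMod p) ^ k).val := by
    induction k with
    | zero =>
      have : Fact (1 < p) := ⟨hp.one_lt⟩
      simp only [hT, ← hexp, pow_zero, ZMod.val_one, Nat.cast_one]
      field_simp
    | succ k ih =>
      set m : ℤ := ℓ * ((ℓ : ZMod p) ^ k).val - p * x (k + 1) with hm
      have h1 : (p : ℝ) * T (k + 1) = m := by
        have : T (k + 1) = ℓ * T k - x (k + 1) := by rw [hTs]; ring
        rw [this, hm]
        push_cast
        rw [← ih]
        ring
      have h2 : (m : ZMod p) = (ℓ : ZMod p) ^ (k + 1) := by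
        rw [hm]
        push_cast
        rw [ZMod.natCast_zmod_val]
        simp [pow_succ']
      have h3 : 0 ≤ m := by
        have : (0 : ℝ) ≤ m := h1 ▸ mul_nonneg hp0.le (hT0 _)
        exact_mod_cast this
      have h4 : m ≤ p := by
        have : (m : ℝ) ≤ p := h1 ▸ mul_le_of_le_one_right hp0.le (hT1 _)
        exact_mod_cast this
      have h5 : m ≠ p := by
        intro h
        rw [h] at h2
        simp only [Int.cast_natCast, CharP.cast_eq_zero] at h2
        exact pow_ne_zero _ hℓp h2.symm
      lift m to ℕ using h3 with m'
      rw [h1, ← h2]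
      simp only [Int.cast_natCast]
      rw [ZMod.val_natCast_of_lt (by omega)]
  have h := hTs k
  have : (p : ℝ) * x (k + 1) = ℓ * ((ℓ : ZMod p) ^ k).val - ((ℓ : ZMod p) ^ (k + 1)).val := by
    rw [← key, ← key, show (x (k + 1) : ℝ) = ℓ * T k - T (k + 1) by rw [h]; ring]
    ring
  exact_mod_cast this

theorem quadraticChar_primitiveRoot {p : ℕ} [Fact p.Prime] (hp : p ≠ 2) {g : ZMod p}
    (hg : orderOf g = p - 1) : quadraticChar (ZMod p) g = -1 := by
  have h2 := (Fact.out : p.Prime).two_le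
  have hg0 : g ≠ 0 := by
    rintro rfl
    rw [orderOf_eq_zero_iff'.mpr] at hg
    · omega
    · intro n hn
      simp [hn.ne']
  refine (quadraticChar_dichotomy hg0).resolve_left fun h ↦ ?_
  have h1 := quadraticChar_eq_pow_of_char_ne_two' (F := ZMod p) (by rwa [ZMod.ringChar_zmod_n]) g
  rw [h, ZMod.card] at h1
  have := orderOf_dvd_of_pow_eq_one (x := g) (n := p / 2) (by simpa using h1.symm)
  rw [hg] at this
  have := Nat.le_of_dvd (by omega) this
  have := (Fact.out : p.Prime).eq_two_or_odd
  omega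

theorem sum_primitiveRoot_pow {p : ℕ} [Fact p.Prime] {g : ZMod p} (hg : orderOf g = p - 1)
    {M : Type*} [AddCommMonoid M] (f : ZMod p → M) (hf : f 0 = 0) :
    ∑ k ∈ Finset.range (p - 1), f (g ^ k) = ∑ a, f a := by
  have h2 := (Fact.out : p.Prime).two_le
  have hg0 : g ≠ 0 := by
    rintro rfl
    rw [orderOf_eq_zero_iff'.mpr] at hg
    · omega
    · intro n hn
      simp [hn.ne']
  have hinj : Set.InjOn (fun k ↦ g ^ k) (Finset.range (p - 1)) := by
    rw [← hg]
    intro a ha b hb h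
    exact pow_injOn_Iio_orderOf (by simpa using ha) (by simpa using hb) h
  rw [← Finset.sum_image (s := Finset.range (p - 1)) (g := fun k ↦ g ^ k) hinj,
    ← Finset.sum_erase (Finset.univ : Finset (ZMod p)) hf]
  refine Finset.sum_congr (Finset.eq_of_subset_of_card_le ?_ ?_) fun _ _ ↦ rfl
  · intro a ha
    obtain ⟨k, -, rfl⟩ := Finset.mem_image.mp ha
    simp [hg0]
  · rw [Finset.card_image_of_injOn hinj]
    simp [ZMod.card]

theorem sum_alternating_digits {p : ℕ} [Fact p.Prime] (hp2 : p ≠ 2) {ℓ : ℕ} (hℓ : 2 ≤ ℓ)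
    (hprim : orderOf (ℓ : ZMod p) = p - 1) {x : ℕ → ℕ} (hdig : ∀ n, x n < ℓ)
    (hexp : (1 : ℝ) / p = ∑' n : ℕ, (x (n + 1) : ℝ) / (ℓ : ℝ) ^ (n + 1)) :
    (p : ℤ) * ∑ n ∈ Finset.Icc 1 (p - 1), (-1 : ℤ) ^ n * (x n : ℤ) =
      -(ℓ + 1) * ∑ a : ZMod p, quadraticChar (ZMod p) a * (a.val : ℤ) := by
  have hp : p.Prime := Fact.out
  have hodd := hp.eq_two_or_odd.resolve_left hp2
  have hχ := quadraticChar_primitiveRoot hp2 hprim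
  have hℓ0 : (ℓ : ZMod p) ≠ 0 := by
    intro h
    rw [h] at hχ
    simp at hχ
  set r : ℕ → ℤ := fun k ↦ (((ℓ : ZMod p) ^ k).val : ℤ) with hr
  have hsum : ∑ a : ZMod p, quadraticChar (ZMod p) a * (a.val : ℤ) =
      ∑ k ∈ Finset.range (p - 1), (-1) ^ k * r k := by
    rw [← sum_primitiveRoot_pow hprim (fun a ↦ quadraticChar (ZMod p) a * (a.val : ℤ)) (by simp)]
    simp only [map_pow, hχ, hr]
  have hper : r (p - 1) = r 0 := by
    simp only [hr, pow_zero]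
    rw [← hprim, pow_orderOf_eq_one]
  have htel : ∑ k ∈ Finset.range (p - 1), (-1 : ℤ) ^ (k + 1) * r (k + 1) =
      ∑ k ∈ Finset.range (p - 1), (-1) ^ k * r k := by
    have h1 := Finset.sum_range_succ (fun k ↦ (-1 : ℤ) ^ k * r k) (p - 1)
    rw [Finset.sum_range_succ'] at h1
    have : Even (p - 1) := by rw [Nat.even_iff]; omega
    rw [this.neg_one_pow, hper, pow_zero] at h1
    exact add_right_cancel h1
  have hIcc : ∑ n ∈ Finset.Icc 1 (p - 1), (-1 : ℤ) ^ n * (x n : ℤ) =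
      ∑ k ∈ Finset.range (p - 1), (-1 : ℤ) ^ (k + 1) * x (k + 1) := by
    rw [Finset.range_eq_Ico, Finset.sum_Ico_add' (fun n ↦ (-1 : ℤ) ^ n * (x n : ℤ)) 0 (p - 1) 1]
    rfl
  rw [hIcc, hsum, Finset.mul_sum]
  have : ∀ k, (p : ℤ) * ((-1 : ℤ) ^ (k + 1) * x (k + 1)) =
      -ℓ * ((-1) ^ k * r k) - (-1 : ℤ) ^ (k + 1) * r (k + 1) := by
    intro k
    have := digit_eq hℓ hℓ0 hdig hexp k
    linear_combination (-1 : ℤ) ^ (k + 1) * this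
  simp only [this, Finset.sum_sub_distrib, htel, ← Finset.mul_sum]
  ring

open Polynomial in
theorem sum_eval_monic_of_natDegree_eq {F : Type*} [Field F] [Fintype F] {Q : F[X]}
    (hQ : Q.Monic) (hdeg : Q.natDegree = Fintype.card F - 1) : ∑ a, Q.eval a = -1 := by
  classical
  have hcard := Fintype.one_lt_card (α := F)
  simp_rw [eval_eq_sum_range]
  rw [Finset.sum_comm, Finset.sum_range_succ, Finset.sum_eq_zero, zero_add]
  · simp_rw [← Finset.mul_sum]
    rw [coeff_natDegree, hQ.leadingCoeff, one_mul, hdeg]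
    have : ∀ a : F, a ^ (Fintype.card F - 1) = 1 - if a = 0 then 1 else 0 := by
      intro a
      split_ifs with h
      · rw [h, zero_pow (by omega)]; simp
      · rw [FiniteField.pow_card_sub_one_eq_one a h]; simp
    simp_rw [this]
    simp
  · intro i hi
    rw [Finset.mem_range, hdeg] at hi
    rw [← Finset.mul_sum, FiniteField.sum_pow_lt_card_sub_one F i hi, mul_zero]

/-- The polynomial whose value at `exp (2πi/p)` is the quadratic Gauss sum. -/
noncomputable def gaussPoly (p : ℕ) [Fact p.Prime] : Polynomial ℤ :=
  ∑ a : ZMod p, Polynomial.C (quadraticChar (ZMod p) a) * Polynomial.X ^ a.val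

/-- Half of the factors of `1 - X ^ k`, normalised so that the value at `exp (2πi/p)` with
`p = 2 * m + 1` is `∏ (-1) ^ k * 2i * sin (π k / p)`. -/
noncomputable def sineProductPoly (m : ℕ) : Polynomial ℤ :=
  ∏ k ∈ Finset.range m, Polynomial.X ^ (m * (k + 1)) * (Polynomial.X ^ (k + 1) - 1)

open Polynomial in
theorem taylor_gaussPoly_coeff {p m : ℕ} [Fact p.Prime] (hp : p = 2 * m + 1) :
    (m.factorial : ZMod p) * (taylor 1 ((gaussPoly p).map (Int.castRingHom (ZMod p)))).coeff m
      = -1 := by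
  have hchar : ringChar (ZMod p) ≠ 2 := by rw [ZMod.ringChar_zmod_n]; omega
  have hχ (a : ZMod p) : ((quadraticChar (ZMod p) a : ℤ) : ZMod p) = a ^ m := by
    rw [quadraticChar_eq_pow_of_char_ne_two' hchar, ZMod.card]
    congr 1
    omega
  have hQ : (X ^ m * descPochhammer (ZMod p) m).Monic :=
    (monic_X_pow m).mul (monic_descPochhammer _ m)
  rw [← sum_eval_monic_of_natDegree_eq hQ]
  · rw [gaussPoly, Polynomial.map_sum, map_sum, finsetSum_coeff, Finset.mul_sum]
    refine Finset.sum_congr rfl fun a _ ↦ ?_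
    have h1 := descPochhammer_eval_eq_descFactorial (ZMod p) a.val m
    rw [ZMod.natCast_zmod_val, Nat.descFactorial_eq_factorial_mul_choose] at h1
    rw [Polynomial.map_mul, Polynomial.map_C, Polynomial.map_pow, Polynomial.map_X, taylor_mul,
      taylor_C, taylor_X_pow, coeff_C_mul, eq_intCast, hχ, eval_mul, eval_pow, eval_X, h1,
      add_comm, C_1, coeff_one_add_X_pow]
    push_cast
    ring
  · rw [(monic_X_pow m).natDegree_mul (monic_descPochhammer _ m), natDegree_X_pow,
      descPochhammer_natDegree, ZMod.card]
    omega

open Polynomial in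
theorem taylor_sineProductPoly_coeff (R : Type*) [CommRing R] (m : ℕ) :
    (taylor 1 ((sineProductPoly m).map (Int.castRingHom R))).coeff m = m.factorial := by
  set U : R[X] := ∏ k ∈ Finset.range m, X ^ (m * (k + 1)) * ∑ i ∈ Finset.range (k + 1), X ^ i
    with hU
  have h1 : (sineProductPoly m).map (Int.castRingHom R) = (X - C 1) ^ m * U := by
    rw [sineProductPoly, Polynomial.map_prod, hU, ← Finset.card_range m, ← Finset.prod_const,
      Finset.card_range, ← Finset.prod_mul_distrib]
    refine Finset.prod_congr rfl fun k _ ↦ ?_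
    rw [Polynomial.map_mul, Polynomial.map_pow, Polynomial.map_sub, Polynomial.map_pow,
      Polynomial.map_X, Polynomial.map_one, ← geom_sum_mul, C_1]
    ring
  rw [h1, taylor_mul, taylor_pow, map_sub, taylor_X, taylor_C, add_sub_cancel_right,
    coeff_X_pow_mul', if_pos le_rfl, Nat.sub_self, taylor_coeff_zero, hU, eval_prod]
  simp only [eval_mul, eval_pow, eval_X, one_pow, one_mul, eval_finsetSum, Finset.sum_const,
    Finset.card_range, nsmul_eq_mul, mul_one]
  rw [← Finset.prod_range_add_one_eq_factorial]
  push_cast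
  rfl

open Polynomial in
/-- A congruence modulo `p` which pins down the sign of the quadratic Gauss sum. -/
theorem sign_eq_neg_one_of_aeval_gaussPoly {p m : ℕ} [Fact p.Prime] (hp : p = 2 * m + 1)
    (hp3 : p % 4 = 3) {ζ : ℂ} (hζ : IsPrimitiveRoot ζ p) {ε : ℤ} (hε : ε = 1 ∨ ε = -1)
    (h : aeval ζ (gaussPoly p) = ε * aeval ζ (sineProductPoly m)) : ε = -1 := by
  have hp' : p.Prime := Fact.out
  have hdvd : cyclotomic p ℤ ∣ gaussPoly p - C ε * sineProductPoly m := by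
    rw [cyclotomic_eq_minpoly hζ hp'.pos]
    refine minpoly.isIntegrallyClosed_dvd (hζ.isIntegral hp'.pos) ?_
    rw [map_sub, map_mul, aeval_C, h]
    simp
  obtain ⟨q, hq⟩ := hdvd
  have h1 := congrArg (fun f ↦ (taylor 1 (Polynomial.map (Int.castRingHom (ZMod p)) f)).coeff m) hq
  have hcyc : cyclotomic p (ZMod p) = (X - C 1) ^ (p - 1) := by
    have := cyclotomic_mul_prime_eq_pow_of_not_dvd (ZMod p) (p := p) (n := 1)
      (by rw [Nat.dvd_one]; omega)
    rwa [one_mul, cyclotomic_one, ← C_1] at this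
  simp only [Polynomial.map_sub, Polynomial.map_mul, map_cyclotomic, hcyc, Polynomial.map_C,
    map_sub, taylor_mul, taylor_C, taylor_pow, taylor_X, coeff_sub, coeff_C_mul,
    taylor_sineProductPoly_coeff, add_sub_cancel_right] at h1
  rw [coeff_X_pow_mul', if_neg (by omega), sub_eq_zero] at h1
  have h2 := taylor_gaussPoly_coeff hp
  rw [h1, eq_intCast] at h2
  rcases hε with rfl | rfl
  · exfalso
    have : IsSquare (-1 : ZMod p) := ⟨m.factorial, by rw [← h2]; simp⟩
    exact ZMod.exists_sq_eq_neg_one_iff.mp this hp3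
  · rfl

open Complex in
theorem aeval_sineProductPoly {p m : ℕ} (hp : p = 2 * m + 1) (hp3 : p % 4 = 3) :
    ∃ s : ℝ, 0 < s ∧ Polynomial.aeval (exp (2 * Real.pi * I / p)) (sineProductPoly m) = -I * s := by
  have hp0 : (p : ℂ) ≠ 0 := by simp; omega
  refine ⟨∏ k ∈ Finset.range m, (2 * Real.sin (Real.pi * (k + 1) / p)), ?_, ?_⟩
  · refine Finset.prod_pos fun k hk ↦ ?_
    rw [Finset.mem_range] at hk
    have : (0 : ℝ) < p := by exact_mod_cast (by omega : 0 < p)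
    have h2 : ((k + 1 : ℕ) : ℝ) < p := by exact_mod_cast (by omega : k + 1 < p)
    push_cast at h2
    refine mul_pos two_pos (Real.sin_pos_of_pos_of_lt_pi (by positivity) ?_)
    rw [div_lt_iff₀ this]
    exact mul_lt_mul_of_pos_left h2 Real.pi_pos
  · have hfac (k : ℕ) : exp (2 * Real.pi * I / p) ^ (m * (k + 1)) *
        (exp (2 * Real.pi * I / p) ^ (k + 1) - 1) =
        (-1) ^ (k + 1) * I * ((2 * Real.sin (Real.pi * (k + 1) / p) : ℝ) : ℂ) := by
      set θ : ℝ := Real.pi * (k + 1) / p with hθ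
      have hmk : exp (2 * Real.pi * I / p) ^ (m * (k + 1)) * exp (θ * I) = (-1) ^ (k + 1) := by
        rw [← exp_pi_mul_I, ← exp_nat_mul, ← exp_nat_mul, ← exp_add, hθ]
        congr 1
        have : (p : ℂ) = 2 * m + 1 := by exact_mod_cast hp
        push_cast
        field_simp
        rw [this]
        ring
      have hk : exp (2 * Real.pi * I / p) ^ (k + 1) = exp (θ * I) * exp (θ * I) := by
        rw [← exp_nat_mul, ← exp_add, hθ]
        congr 1
        push_cast
        field_simp
        ring
      have hone : exp (θ * I) * exp (-θ * I) = 1 := by rw [← exp_add]; simp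
      have hsin := two_sin (θ : ℂ)
      rw [← hmk, hk, ofReal_mul, ofReal_sin, ofReal_ofNat, hsin, ← hone]
      linear_combination (-exp (2 * Real.pi * I / p) ^ (m * (k + 1)) * exp (θ * I) *
        (exp (-θ * I) - exp (θ * I))) * I_sq
    rw [sineProductPoly, map_prod]
    simp only [map_mul, map_pow, Polynomial.aeval_X, map_sub, map_one, hfac]
    rw [Finset.prod_mul_distrib, Finset.prod_mul_distrib, ← ofReal_prod]
    congr 1
    obtain ⟨t, rfl⟩ : ∃ t, m = 2 * t + 1 := ⟨m / 2, by omega⟩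
    clear * -
    induction t with
    | zero => simp
    | succ t ih =>
      rw [show 2 * (t + 1) + 1 = 2 * t + 1 + 1 + 1 by ring]
      simp only [Finset.prod_range_succ _ (2 * t + 1 + 1), Finset.prod_range_succ _ (2 * t + 1)]
      linear_combination (norm := skip) ih
      have h4 : ((-1 : ℂ) ^ t) ^ 4 = 1 := by rw [← pow_mul, mul_comm, pow_mul]; norm_num
      ring_nf
      rw [pow_mul _ t 4, h4, I_sq]
      ring

open Polynomial in
theorem aeval_sineProductPoly_sq {p m : ℕ} (hp : p = 2 * m + 1) (hm : Odd m) {ζ : ℂ}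
    (hζ : IsPrimitiveRoot ζ p) : aeval ζ (sineProductPoly m) ^ 2 = -p := by
  have hζp : ζ ^ (2 * m + 1) = 1 := hp ▸ hζ.pow_eq_one
  have h1 := IsPrimitiveRoot.prod_one_sub_pow_eq_order (n := 2 * m) (hp ▸ hζ)
  rw [two_mul m, Finset.prod_range_add,
    ← Finset.prod_range_reflect (fun x ↦ 1 - ζ ^ (m + x + 1)), ← Finset.prod_mul_distrib] at h1
  have hp1 : (p : ℂ) = (m + m : ℕ) + 1 := by rw [hp]; push_cast; ring
  rw [hp1, ← h1, sineProductPoly, map_prod, ← Finset.prod_pow, ← neg_one_mul,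
    ← hm.neg_one_pow, ← Finset.card_range m, ← Finset.prod_const, Finset.card_range,
    ← Finset.prod_mul_distrib]
  refine Finset.prod_congr rfl fun k hk ↦ ?_
  rw [Finset.mem_range] at hk
  simp only [map_mul, map_pow, aeval_X, map_sub, map_one]
  have e1 : ζ ^ (m + (m - 1 - k) + 1) * ζ ^ (k + 1) = 1 := by
    rw [← pow_add, ← hζp]
    congr 1
    omega
  have e2 : (ζ ^ (m * (k + 1))) ^ 2 * ζ ^ (k + 1) = 1 := by
    rw [← pow_mul, ← pow_add, show m * (k + 1) * 2 + (k + 1) = (2 * m + 1) * (k + 1) by ring,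
      pow_mul, hζp, one_pow]
  have e3 : ζ ^ (m + (m - 1 - k) + 1) = (ζ ^ (m * (k + 1))) ^ 2 := by
    have : ζ ^ (k + 1) ≠ 0 := by
      intro h
      rw [h, mul_zero] at e1
      exact zero_ne_one e1
    exact mul_right_cancel₀ this (e1.trans e2.symm)
  rw [e3]
  linear_combination (ζ ^ (k + 1) - 1) * e2

/-- The quadratic character modulo `p`, with complex values. -/
noncomputable def quadraticDirichletCharacter (p : ℕ) [Fact p.Prime] : DirichletCharacter ℂ p :=
  (quadraticChar (ZMod p)).ringHomComp (Int.castRingHom ℂ)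

theorem quadraticDirichletCharacter_apply {p : ℕ} [Fact p.Prime] (a : ZMod p) :
    quadraticDirichletCharacter p a = (quadraticChar (ZMod p) a : ℤ) := rfl

/-- The sign of the quadratic Gauss sum for `p ≡ 3 (mod 4)`. -/
theorem gaussSum_quadraticDirichletCharacter {p : ℕ} [Fact p.Prime] (hp3 : p % 4 = 3) :
    gaussSum (quadraticDirichletCharacter p) ZMod.stdAddChar = Complex.I * (√p : ℝ) := by
  have hp' : p.Prime := Fact.out
  obtain ⟨m, hp⟩ : ∃ m, p = 2 * m + 1 := ⟨p / 2, by omega⟩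
  have hchar : ringChar (ZMod p) ≠ 2 := by rw [ZMod.ringChar_zmod_n]; omega
  set ζ : ℂ := Complex.exp (2 * Real.pi * Complex.I / p) with hζdef
  have hζ : IsPrimitiveRoot ζ p := Complex.isPrimitiveRoot_exp p hp'.ne_zero
  set g := gaussSum (quadraticDirichletCharacter p) ZMod.stdAddChar with hg
  have hgp : g = Polynomial.aeval ζ (gaussPoly p) := by
    rw [hg, gaussSum, gaussPoly, map_sum]
    refine Finset.sum_congr rfl fun a _ ↦ ?_
    rw [map_mul, Polynomial.aeval_C, map_pow, Polynomial.aeval_X,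
      quadraticDirichletCharacter_apply, hζdef, ← Complex.exp_nat_mul]
    have h1 := ZMod.stdAddChar_coe (N := p) a.val
    rw [Int.cast_natCast, ZMod.natCast_zmod_val] at h1
    rw [h1]
    congr 2
    push_cast
    ring
  have hsq : g ^ 2 = -p := by
    have hne : quadraticDirichletCharacter p ≠ 1 :=
      (MulChar.ringHomComp_ne_one_iff (RingHom.injective_int _)).mpr (quadraticChar_ne_one hchar)
    rw [hg, gaussSum_sq hne (quadraticChar_isQuadratic (ZMod p) |>.comp _)
      (ZMod.isPrimitive_stdAddChar p), ZMod.card, quadraticDirichletCharacter_apply,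
      quadraticChar_neg_one hchar, ZMod.card, ZMod.χ₄_nat_three_mod_four hp3]
    simp
  have hRsq := aeval_sineProductPoly_sq hp (by rw [Nat.odd_iff]; omega) hζ
  obtain ⟨s, hs, hR⟩ := aeval_sineProductPoly hp hp3
  rw [← hζdef] at hR
  have hs2 : s = √p := by
    rw [hR, mul_pow, neg_sq, Complex.I_sq, neg_one_mul, neg_inj] at hRsq
    have : s ^ 2 = p := by exact_mod_cast hRsq
    rw [← this, Real.sqrt_sq hs.le]
  have hε : ∃ ε : ℤ, (ε = 1 ∨ ε = -1) ∧ g = ε * Polynomial.aeval ζ (sineProductPoly m) := by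
    rcases sq_eq_sq_iff_eq_or_eq_neg.mp (hsq.trans hRsq.symm) with h | h
    · exact ⟨1, Or.inl rfl, by rw [h]; simp⟩
    · exact ⟨-1, Or.inr rfl, by rw [h]; simp⟩
  obtain ⟨ε, h1, h2⟩ := hε
  rw [h2, sign_eq_neg_one_of_aeval_gaussPoly hp hp3 hζ h1 (hgp ▸ h2), hR, hs2]
  simp

open Filter Topology MeasureTheory in
theorem exists_tendsto_sum_div_and_tendsto_LSeries {f : ℕ → ℂ} (hf0 : f 0 = 0) {C : ℝ}
    (hC : ∀ n, ‖∑ k ∈ Finset.Icc 0 n, f k‖ ≤ C)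
    (hsum : ∀ s : ℝ, 1 < s → LSeriesSummable f s) :
    ∃ S : ℂ, Tendsto (fun n ↦ ∑ k ∈ Finset.range n, f k / k) atTop (𝓝 S) ∧
      Tendsto (fun s : ℝ ↦ LSeries f s) (𝓝[>] 1) (𝓝 S) := by
  have hC0 : 0 ≤ C := (norm_nonneg _).trans (hC 0)
  have hpow : ∀ t : ℝ, 0 < t → deriv (fun t : ℝ ↦ ((t : ℂ))⁻¹) t = -((t : ℂ) ^ 2)⁻¹ := by
    intro t ht
    have h := ((hasDerivAt_inv (x := (t : ℂ)) (by exact_mod_cast ht.ne')).comp_ofReal).deriv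
    exact h
  have hcont : ContinuousOn (fun t : ℝ ↦ -((t : ℂ) ^ 2)⁻¹) (Set.Ici 1) := by
    refine ContinuousOn.neg (ContinuousOn.inv₀ (by fun_prop) fun t ht ↦ ?_)
    have : t ≠ 0 := (zero_lt_one.trans_le ht).ne'
    exact_mod_cast pow_ne_zero 2 this
  refine ⟨∫ t in Set.Ioi (1 : ℝ), (∑ k ∈ Finset.Icc 0 ⌊t⌋₊, f k) * (t : ℂ) ^ (-((1 : ℝ) + 1 : ℂ)),
    ?_, ?_⟩
  · have key := tendsto_sum_mul_atTop_nhds_one_sub_integral₀ (𝕜 := ℂ) (c := f)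
      (f := fun t : ℝ ↦ ((t : ℂ))⁻¹) (l := 0) (g := fun t ↦ t ^ (-2 : ℝ)) hf0
      (fun t ht ↦ ?_) ?_ ?_ ?_ ?_
    · rw [zero_sub, ← integral_neg] at key
      have h2 := (tendsto_add_atTop_iff_nat (f := fun n ↦ ∑ k ∈ Finset.range n, f k / k) 1).mp
        (key.congr fun n ↦ ?_)
      · convert h2 using 2
        refine setIntegral_congr_fun measurableSet_Ioi fun t ht ↦ ?_
        have ht : (0 : ℝ) < t := zero_lt_one.trans ht
        rw [hpow t ht, Complex.cpow_neg]
        norm_num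
        ring
      · rw [Nat.range_succ_eq_Icc_zero]
        exact Finset.sum_congr rfl fun k _ ↦ by rw [div_eq_inv_mul]; simp
    · have h0 : (t : ℂ) ≠ 0 := by exact_mod_cast (zero_lt_one.trans_le ht).ne'
      exact ((hasDerivAt_inv h0).comp_ofReal).differentiableAt
    · exact (hcont.congr fun t ht ↦ hpow t (zero_lt_one.trans_le ht)).locallyIntegrableOn
        measurableSet_Ici
    · have h1 : Tendsto (fun n : ℕ ↦ (n : ℝ)⁻¹ * C) atTop (𝓝 0) := by
        simpa using (tendsto_inv_atTop_nhds_zero_nat (𝕜 := ℝ)).mul_const C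
      refine squeeze_zero_norm (fun n ↦ ?_) h1
      rw [norm_mul, norm_inv]
      simpa using mul_le_mul_of_nonneg_left (hC n) (by positivity : (0 : ℝ) ≤ (n : ℝ)⁻¹)
    · refine Asymptotics.IsBigO.of_bound C ?_
      filter_upwards [eventually_gt_atTop 0] with t ht
      rw [hpow t ht, norm_mul, mul_comm, norm_neg, norm_inv, norm_pow, Complex.norm_real]
      refine mul_le_mul (hC _) (le_of_eq ?_) (by positivity) hC0
      rw [Real.norm_of_nonneg ht.le, Real.norm_of_nonneg (by positivity), Real.rpow_neg ht.le]
      norm_num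
    · exact ⟨Set.Ioi 1, Ioi_mem_atTop 1, integrableOn_Ioi_rpow_of_lt (by norm_num) one_pos⟩
  · have hintegral : Tendsto (fun s : ℝ ↦ ∫ t in Set.Ioi (1 : ℝ),
        (∑ k ∈ Finset.Icc 0 ⌊t⌋₊, f k) * (t : ℂ) ^ (-(s + 1 : ℂ))) (𝓝[>] 1)
        (𝓝 (∫ t in Set.Ioi (1 : ℝ),
          (∑ k ∈ Finset.Icc 0 ⌊t⌋₊, f k) * (t : ℂ) ^ (-((1 : ℝ) + 1 : ℂ)))) := by
      refine tendsto_integral_filter_of_dominated_convergence (fun t ↦ C * t ^ (-2 : ℝ)) ?_ ?_ ?_ ?_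
      · refine Eventually.of_forall fun s ↦ Measurable.aestronglyMeasurable ?_
        have h1 : Measurable fun t : ℝ ↦ ∑ k ∈ Finset.Icc 0 ⌊t⌋₊, f k :=
          (measurable_from_top (f := fun n : ℕ ↦ ∑ k ∈ Finset.Icc 0 n, f k)).comp
            Nat.measurable_floor
        exact h1.mul (by fun_prop)
      · filter_upwards [self_mem_nhdsWithin] with s hs
        filter_upwards [ae_restrict_mem measurableSet_Ioi] with t ht
        have ht0 : (0 : ℝ) < t := zero_lt_one.trans ht
        rw [norm_mul, Complex.norm_cpow_eq_rpow_re_of_pos ht0]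
        refine mul_le_mul (hC _) (Real.rpow_le_rpow_of_exponent_le (le_of_lt ht) ?_)
          (by positivity) hC0
        have : (1 : ℝ) < s := hs
        simp
        linarith
      · exact (integrableOn_Ioi_rpow_of_lt (by norm_num) one_pos).const_mul C
      · filter_upwards [ae_restrict_mem measurableSet_Ioi] with t ht
        have ht0 : (t : ℂ) ≠ 0 := by exact_mod_cast (zero_lt_one.trans ht).ne'
        refine tendsto_nhdsWithin_of_tendsto_nhds ?_
        refine Tendsto.const_mul _ (ContinuousAt.tendsto (f := fun s : ℝ ↦ (t : ℂ) ^ (-(s + 1 : ℂ))) ?_)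
        exact (continuousAt_const_cpow ht0).comp (by fun_prop)
    have h2 := ((Complex.continuous_ofReal.tendsto (1 : ℝ)).mono_left nhdsWithin_le_nhds).mul hintegral
    rw [Complex.ofReal_one, one_mul] at h2
    refine h2.congr' ?_
    filter_upwards [self_mem_nhdsWithin] with s hs
    have hs : (1 : ℝ) < s := hs
    have hIcc : ∀ n, ∑ k ∈ Finset.Icc 1 n, f k = ∑ k ∈ Finset.Icc 0 n, f k := fun n ↦ by
      rw [← Finset.add_sum_Ioc_eq_sum_Icc (Nat.zero_le n), hf0, zero_add]
      rfl
    rw [LSeries_eq_mul_integral f le_rfl (by simpa using one_pos.trans hs) (hsum s hs)]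
    · simp_rw [hIcc]
    · refine Asymptotics.IsBigO.of_bound C (Eventually.of_forall fun n ↦ ?_)
      rw [hIcc]
      simpa using hC n

theorem DirichletCharacter.norm_sum_Icc_le {N : ℕ} [NeZero N] {χ : DirichletCharacter ℂ N}
    (hχ : χ ≠ 1) (n : ℕ) : ‖∑ k ∈ Finset.Icc 0 n, χ k‖ ≤ N := by
  rw [← Nat.range_succ_eq_Icc_zero]
  have hper : Function.Periodic (fun n : ℕ ↦ ∑ k ∈ Finset.range n, χ k) N := fun n ↦ by
    have h : ∑ i ∈ Finset.range N, χ ((n + i : ℕ) : ZMod N) = 0 := by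
      rw [← MulChar.sum_eq_zero_of_ne_one hχ, ← Equiv.sum_comp (Equiv.addLeft (n : ZMod N))]
      refine Finset.sum_bij' (fun i _ ↦ (i : ZMod N)) (fun a _ ↦ a.val) ?_ ?_ ?_ ?_ ?_
      · simp
      · exact fun a _ ↦ Finset.mem_range.mpr a.val_lt
      · exact fun i hi ↦ ZMod.val_cast_of_lt (Finset.mem_range.mp hi)
      · simp
      · simp
    simp only [Finset.sum_range_add, h, add_zero]
  have h := hper.map_mod_nat (n + 1)
  rw [← h]
  refine (norm_sum_le _ _).trans ((Finset.sum_le_card_nsmul _ _ 1 fun k _ ↦ χ.norm_le_one _).trans ?_)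
  rw [Finset.card_range, nsmul_eq_mul, mul_one]
  exact_mod_cast (Nat.mod_lt _ (NeZero.pos N)).le

theorem Complex.arg_one_sub_exp_ofReal_mul_I {t : ℝ} (h0 : 0 < t) (h1 : t < 2 * Real.pi) :
    (1 - Complex.exp (t * Complex.I)).arg = (t - Real.pi) / 2 := by
  have hs : 0 < 2 * Real.sin (t / 2) :=
    mul_pos two_pos (Real.sin_pos_of_pos_of_lt_pi (by linarith) (by linarith))
  have h : 1 - Complex.exp (t * Complex.I) = (2 * Real.sin (t / 2) : ℝ) *
      (Complex.cos ((t - Real.pi) / 2 : ℝ) + Complex.sin ((t - Real.pi) / 2 : ℝ) * Complex.I) := by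
    rw [Complex.exp_mul_I, ← Complex.ofReal_cos, ← Complex.ofReal_sin, ← Complex.ofReal_cos,
      ← Complex.ofReal_sin]
    rw [sub_div, Real.cos_sub_pi_div_two, Real.sin_sub_pi_div_two]
    have e1 : Real.cos t = 1 - 2 * Real.sin (t / 2) ^ 2 := by
      have := Real.cos_two_mul (t / 2)
      rw [mul_div_cancel₀ t two_ne_zero] at this
      rw [this, Real.cos_sq']
      ring
    have e2 : Real.sin t = 2 * Real.sin (t / 2) * Real.cos (t / 2) := by
      have := Real.sin_two_mul (t / 2)
      rwa [mul_div_cancel₀ t two_ne_zero] at this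
    rw [e1, e2]
    push_cast
    ring
  rw [h, Complex.arg_mul_cos_add_sin_mul_I hs ⟨by linarith, by linarith⟩]

open Filter Topology in
theorem DirichletCharacter.gaussSum_mul_of_tendsto_sum_div {N : ℕ} [NeZero N]
    {χ : DirichletCharacter ℂ N} (hN : ¬ IsUnit (0 : ZMod N))
    (hχ : ∀ a, gaussSum χ (ZMod.stdAddChar.mulShift a) = χ a * gaussSum χ ZMod.stdAddChar)
    {S : ℂ} (hS : Tendsto (fun n ↦ ∑ k ∈ Finset.range n, χ k / k) atTop (𝓝 S)) :
    gaussSum χ ZMod.stdAddChar * S =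
      ∑ a : ZMod N, χ a * -Complex.log (1 - ZMod.stdAddChar a) := by
  have habel := (Complex.tendsto_tsum_powerSeries_nhdsWithin_lt hS).const_mul
    (gaussSum χ ZMod.stdAddChar)
  have hnorm : ∀ a : ZMod N, ‖ZMod.stdAddChar a‖ = 1 := fun a ↦ by simp
  have hlim : Tendsto (fun r : ℝ ↦ ∑ a : ZMod N, χ a * -Complex.log (1 - r * ZMod.stdAddChar a))
      (𝓝[<] 1) (𝓝 (∑ a : ZMod N, χ a * -Complex.log (1 - ZMod.stdAddChar a))) := by
    refine tendsto_finsetSum _ fun a _ ↦ ?_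
    by_cases ha : a = 0
    · simp [ha, MulChar.map_nonunit χ hN]
    refine tendsto_nhdsWithin_of_tendsto_nhds (Tendsto.const_mul _ (Tendsto.neg ?_))
    have hmem : (1 - ((1 : ℝ) : ℂ) * ZMod.stdAddChar a) ∈ Complex.slitPlane := by
      rw [Complex.ofReal_one, one_mul]
      refine Or.inl ?_
      rw [Complex.sub_re, Complex.one_re, sub_pos]
      refine lt_of_le_of_ne ((Complex.re_le_norm _).trans (hnorm a).le) fun h ↦ ha ?_
      have h1 : ZMod.stdAddChar a = (1 : ℂ) := by
        have := Complex.re_eq_norm.mp (h.trans (hnorm a).symm)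
        rw [Complex.eq_coe_norm_of_nonneg this, hnorm]
        simp
      exact ZMod.injective_stdAddChar (h1.trans (AddChar.map_zero_eq_one _).symm)
    have := (ContinuousAt.clog (f := fun r : ℝ ↦ 1 - (r : ℂ) * ZMod.stdAddChar a) (x := 1)
      (by fun_prop) hmem).tendsto
    simpa using this
  refine tendsto_nhds_unique (f := fun r : ℝ ↦ gaussSum χ ZMod.stdAddChar *
    ∑' n : ℕ, χ n / n * (r : ℂ) ^ n) (l := 𝓝[<] (1 : ℝ)) ?_ (hlim.congr' ?_)
  · refine (habel.comp (f := fun r : ℝ ↦ (r : ℂ)) (x := 𝓝[<] 1) ?_)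
    exact tendsto_map
  · filter_upwards [Ioo_mem_nhdsLT (zero_lt_one (α := ℝ))] with r hr
    have hz : ∀ a : ZMod N, ‖(r : ℂ) * ZMod.stdAddChar a‖ < 1 := fun a ↦ by
      rw [norm_mul, hnorm, mul_one, Complex.norm_real, Real.norm_of_nonneg hr.1.le]
      exact hr.2
    have h := hasSum_sum (s := Finset.univ) fun (a : ZMod N) _ ↦
      (Complex.hasSum_taylorSeries_neg_log (hz a)).mul_left (χ a)
    rw [← h.tsum_eq, ← tsum_mul_left]
    refine tsum_congr fun n ↦ ?_
    have := hχ n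
    rw [gaussSum] at this
    rw [show gaussSum χ ZMod.stdAddChar * (χ n / n * (r : ℂ) ^ n) =
      (χ n * gaussSum χ ZMod.stdAddChar) * ((r : ℂ) ^ n / n) by ring, ← this, Finset.sum_mul]
    refine Finset.sum_congr rfl fun a _ ↦ ?_
    rw [AddChar.mulShift_apply, mul_pow, ← AddChar.map_nsmul_eq_pow, nsmul_eq_mul]
    ring

theorem quadraticDirichletCharacter_ne_one {p : ℕ} [Fact p.Prime] (hp : p ≠ 2) :
    quadraticDirichletCharacter p ≠ 1 := by
  obtain ⟨a, ha⟩ := quadraticChar_exists_neg_one' (F := ZMod p) (by rwa [ZMod.ringChar_zmod_n])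
  intro h
  have h1 := congrArg (fun χ ↦ χ (a : ZMod p)) h
  simp only [quadraticDirichletCharacter_apply, ha, MulChar.one_apply_coe] at h1
  norm_num at h1

theorem quadraticDirichletCharacter_gaussSum_mulShift {p : ℕ} [Fact p.Prime] (hp : p ≠ 2)
    (a : ZMod p) : gaussSum (quadraticDirichletCharacter p) (ZMod.stdAddChar.mulShift a) =
      quadraticDirichletCharacter p a * gaussSum (quadraticDirichletCharacter p)
        ZMod.stdAddChar := by
  by_cases ha : a = 0
  · rw [ha, AddChar.mulShift_zero, gaussSum, MulChar.map_zero, zero_mul]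
    simpa using MulChar.sum_eq_zero_of_ne_one (quadraticDirichletCharacter_ne_one hp)
  · have h := gaussSum_mulShift (quadraticDirichletCharacter p) ZMod.stdAddChar
      (Units.mk0 a ha)
    rw [← h, ← mul_assoc, Units.val_mk0, quadraticDirichletCharacter_apply]
    have h2 : ((quadraticChar (ZMod p) a : ℤ) : ℂ) * (quadraticChar (ZMod p) a : ℤ) = 1 := by
      exact_mod_cast (sq _).symm.trans (quadraticChar_sq_one ha)
    rw [h2, one_mul]

open Filter Topology in
theorem tendsto_LSeries_quadraticDirichletCharacter {p : ℕ} [Fact p.Prime] (hp3 : p % 4 = 3) :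
    Tendsto (fun s : ℝ ↦ LSeries (quadraticDirichletCharacter p ·) s) (𝓝[>] 1)
      (𝓝 ((-(Real.pi * ((∑ a : ZMod p, quadraticChar (ZMod p) a * (a.val : ℤ) : ℤ) : ℝ) /
        (p * √p)) : ℝ) : ℂ)) := by
  have hp2 : p ≠ 2 := by omega
  have hp0 : (0 : ℝ) < p := by exact_mod_cast (Fact.out : p.Prime).pos
  have hχ0 : quadraticDirichletCharacter p ((0 : ℕ) : ZMod p) = 0 := by
    rw [Nat.cast_zero, MulChar.map_zero]
  obtain ⟨S, hS, hL⟩ := exists_tendsto_sum_div_and_tendsto_LSeries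
    (f := fun n ↦ quadraticDirichletCharacter p n) hχ0
    (DirichletCharacter.norm_sum_Icc_le (quadraticDirichletCharacter_ne_one hp2))
    (fun s hs ↦ DirichletCharacter.LSeriesSummable_of_one_lt_re _ (by simpa using hs))
  have key := DirichletCharacter.gaussSum_mul_of_tendsto_sum_div (by simp)
    (quadraticDirichletCharacter_gaussSum_mulShift hp2) hS
  have hSre : ((S.re : ℝ) : ℂ) = S := by
    have h := (Complex.continuous_ofReal.tendsto _).comp ((Complex.continuous_re.tendsto _).comp hS)
    refine tendsto_nhds_unique (h.congr fun n ↦ ?_) hS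
    simp only [Function.comp, quadraticDirichletCharacter_apply, Complex.re_sum, Complex.ofReal_sum]
    refine Finset.sum_congr rfl fun k _ ↦ ?_
    rw [show (((quadraticChar (ZMod p) k : ℤ) : ℂ) / k) =
      (((quadraticChar (ZMod p) k : ℤ) / k : ℝ) : ℂ) by push_cast; rfl, Complex.ofReal_re]
  have him := congrArg Complex.im key
  rw [gaussSum_quadraticDirichletCharacter hp3, ← hSre] at him
  have hterm : ∀ a : ZMod p, (quadraticDirichletCharacter p a *
      -Complex.log (1 - ZMod.stdAddChar a)).im =
      (quadraticChar (ZMod p) a : ℤ) * (Real.pi / 2) -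
        (quadraticChar (ZMod p) a : ℤ) * a.val * (Real.pi / p) := by
    intro a
    by_cases ha : a = 0
    · simp [ha, quadraticDirichletCharacter_apply]
    have hv : 0 < a.val := ZMod.val_pos.mpr ha
    have hv' : (a.val : ℝ) < p := by exact_mod_cast a.val_lt
    have hexp : ZMod.stdAddChar a = Complex.exp ((2 * Real.pi * a.val / p : ℝ) * Complex.I) := by
      conv_lhs => rw [← ZMod.natCast_zmod_val a, ← Int.cast_natCast, ZMod.stdAddChar_coe]
      congr 1
      push_cast
      ring
    rw [quadraticDirichletCharacter_apply, hexp, ← Complex.ofReal_intCast, Complex.im_ofReal_mul,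
      Complex.neg_im, Complex.log_im, Complex.arg_one_sub_exp_ofReal_mul_I (by positivity) ?_]
    · field_simp
      ring
    · rw [div_lt_iff₀ hp0]
      exact mul_lt_mul_of_pos_left hv' (by positivity)
  rw [Complex.im_sum, Finset.sum_congr rfl fun a _ ↦ hterm a, Finset.sum_sub_distrib,
    ← Finset.sum_mul, ← Finset.sum_mul] at him
  have h0 : ∑ a : ZMod p, ((quadraticChar (ZMod p) a : ℤ) : ℝ) = 0 := by
    exact_mod_cast quadraticChar_sum_zero (F := ZMod p) (by rwa [ZMod.ringChar_zmod_n])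
  rw [h0, mul_assoc, ← Complex.ofReal_mul, Complex.im_mul_ofReal, Complex.I_im] at him
  rw [← hSre] at hL
  convert hL using 3
  push_cast
  have hsq : √(p : ℝ) ≠ 0 := (Real.sqrt_pos.mpr hp0).ne'
  field_simp at him ⊢
  linear_combination -him / 2

section QuadraticBasis

variable {R S : Type*} [CommRing R] [CommRing S] [Algebra R S]

theorem Algebra.leftMulMatrix_quadratic {b : Module.Basis (Fin 2) R S} {w : S} {s n : R}
    (h0 : b 0 = 1) (h1 : b 1 = w) (hw : w ^ 2 = s • w - n • (1 : S)) (x y : R) :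
    Algebra.leftMulMatrix b (x • (1 : S) + y • w) = !![x, -(n * y); y, x + s * y] := by
  have e0 : (x • (1 : S) + y • w) * b 0 = x • b 0 + y • b 1 := by
    rw [h0, h1, mul_one]
  have e1 : (x • (1 : S) + y • w) * b 1 = -(n * y) • b 0 + (x + s * y) • b 1 := by
    rw [h0, h1, add_mul, smul_mul_assoc, smul_mul_assoc, ← sq, hw, one_mul, smul_sub, smul_smul,
      smul_smul, add_smul, neg_smul, mul_comm n, mul_comm s]
    abel
  ext i j
  rw [Algebra.leftMulMatrix_eq_repr_mul]
  fin_cases j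
  · simp only [Fin.zero_eta, e0]
    fin_cases i <;> simp
  · simp only [Fin.mk_one, e1]
    fin_cases i <;> simp

theorem Algebra.trace_quadratic {b : Module.Basis (Fin 2) R S} {w : S} {s n : R}
    (h0 : b 0 = 1) (h1 : b 1 = w) (hw : w ^ 2 = s • w - n • (1 : S)) (x y : R) :
    Algebra.trace R S (x • (1 : S) + y • w) = 2 * x + s * y := by
  rw [Algebra.trace_eq_matrix_trace b, Algebra.leftMulMatrix_quadratic h0 h1 hw]
  simp [Matrix.trace_fin_two]
  ring

theorem Algebra.norm_quadratic {b : Module.Basis (Fin 2) R S} {w : S} {s n : R}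
    (h0 : b 0 = 1) (h1 : b 1 = w) (hw : w ^ 2 = s • w - n • (1 : S)) (x y : R) :
    Algebra.norm R (x • (1 : S) + y • w) = x ^ 2 + s * x * y + n * y ^ 2 := by
  rw [Algebra.norm_eq_matrix_det b, Algebra.leftMulMatrix_quadratic h0 h1 hw]
  simp [Matrix.det_fin_two]
  ring

end QuadraticBasis

open NumberField

theorem exists_basis_of_sq_eq_neg_prime {p : ℕ} (hp : p.Prime) {K : Type*} [Field K]
    [NumberField K] (hdeg : Module.finrank ℚ K = 2) {θ : K} (hθ : θ ^ 2 = -(p : K)) :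
    ∃ b : Module.Basis (Fin 2) ℚ K, b 0 = 1 ∧ b 1 = θ := by
  have hli : LinearIndependent ℚ ![(1 : K), θ] := by
    rw [LinearIndependent.pair_iff' one_ne_zero]
    intro a ha
    rw [← ha, Algebra.smul_def, mul_one, ← map_pow] at hθ
    have : algebraMap ℚ K (a ^ 2) = algebraMap ℚ K (-p) := by rw [hθ]; simp
    have h2 := (algebraMap ℚ K).injective this
    have : (0 : ℚ) < p := by exact_mod_cast hp.pos
    nlinarith [sq_nonneg a]
  refine ⟨basisOfLinearIndependentOfCardEqFinrank hli (by simp [hdeg]), ?_, ?_⟩ <;> simp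

theorem Rat.exists_int_of_prime_mul_sq {p : ℕ} (hp : p.Prime) {w : ℚ} {m : ℤ}
    (h : p * w ^ 2 = m) : ∃ z : ℤ, w = z := by
  have hp0 : (p : ℚ) ≠ 0 := by exact_mod_cast hp.ne_zero
  have hintegral : IsIntegral ℤ ((p : ℚ) * w) := by
    refine IsIntegral.of_pow two_pos ?_
    rw [show ((p : ℚ) * w) ^ 2 = ((p * m : ℤ) : ℚ) by push_cast; rw [← h]; ring]
    exact isIntegral_algebraMap (R := ℤ) (x := (p * m : ℤ))
  obtain ⟨y, hy⟩ := IsIntegrallyClosed.isIntegral_iff.mp hintegral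
  have hy' : (y : ℚ) = p * w := by simpa using hy
  have hdvd : (p : ℤ) ∣ y ^ 2 := ⟨m, by
    have : (y : ℚ) ^ 2 = p * m := by rw [hy', ← h]; ring
    exact_mod_cast this⟩
  obtain ⟨z, hz⟩ := (Nat.prime_iff_prime_int.mp hp).dvd_of_dvd_pow hdvd
  refine ⟨z, ?_⟩
  rw [hz] at hy'
  push_cast at hy'
  exact (mul_left_cancel₀ hp0 hy').symm

/-- The ring of integers of `ℚ(√-p)` for a prime `p ≡ 3 (mod 4)`. -/
theorem exists_integralBasis_of_sq_eq_neg_prime {p : ℕ} (hp : p.Prime) (hp3 : p % 4 = 3)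
    {K : Type*} [Field K] [NumberField K] (hdeg : Module.finrank ℚ K = 2) {θ : K}
    (hθ : θ ^ 2 = -(p : K)) :
    ∃ b : Module.Basis (Fin 2) ℤ (𝓞 K), b 0 = 1 ∧
      b 1 ^ 2 = (1 : ℤ) • b 1 - (((p + 1) / 4 : ℕ) : ℤ) • (1 : 𝓞 K) := by
  obtain ⟨b, hb0, hb1⟩ := exists_basis_of_sq_eq_neg_prime hp hdeg hθ
  set c : ℕ := (p + 1) / 4 with hc
  have hpc : p + 1 = 4 * c := by omega
  have hpcK : (p : K) = 4 * c - 1 := by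
    rw [eq_sub_iff_add_eq]
    exact_mod_cast hpc
  have hw : ((1 + θ) / 2) ^ 2 = (1 + θ) / 2 - (c : K) := by
    rw [div_pow, add_sq, hθ, hpcK]
    ring
  have hwint : IsIntegral ℤ ((1 + θ) / 2) := by
    refine ⟨Polynomial.X ^ 2 - Polynomial.X + Polynomial.C (c : ℤ), by monicity!, ?_⟩
    simp [hw]
  set ω : 𝓞 K := ⟨(1 + θ) / 2, hwint⟩ with hω
  have hωK : algebraMap (𝓞 K) K ω = (1 + θ) / 2 := rfl
  have hind : ∀ s t : ℚ, s • (1 : K) + t • θ = 0 → s = 0 ∧ t = 0 := by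
    have := b.linearIndependent
    rw [← hb0, ← hb1]
    have h2 := LinearIndependent.pair_iff.mp
      (show LinearIndependent ℚ ![b 0, b 1] by convert this using 1; ext i; fin_cases i <;> rfl)
    exact h2
  have hli : LinearIndependent ℤ ![(1 : 𝓞 K), ω] := by
    rw [LinearIndependent.pair_iff]
    intro s t hst
    have h := congrArg (algebraMap (𝓞 K) K) hst
    simp only [map_add, zsmul_eq_mul, map_mul, map_intCast, map_one, map_zero, hωK] at h
    have h3 := hind (s + t / 2) (t / 2) (by
      rw [Algebra.smul_def, Algebra.smul_def, ← h]
      simp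
      ring)
    have ht : (t : ℚ) = 0 := by linarith [h3.2]
    have hs : (s : ℚ) = 0 := by linarith [h3.1]
    exact ⟨by exact_mod_cast hs, by exact_mod_cast ht⟩
  have hspan : ⊤ ≤ Submodule.span ℤ (Set.range ![(1 : 𝓞 K), ω]) := by
    rintro x -
    rw [Matrix.range_cons, Matrix.range_cons, Matrix.range_empty, Set.union_empty,
      Set.singleton_union, Submodule.mem_span_pair]
    have hθ' : θ ^ 2 = (0 : ℚ) • θ - (p : ℚ) • (1 : K) := by
      rw [hθ, Algebra.smul_def]
      simp
    obtain ⟨u, v, huv⟩ : ∃ u v : ℚ, algebraMap (𝓞 K) K x = u • (1 : K) + v • θ :=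
      ⟨b.repr x 0, b.repr x 1, by
        rw [← hb0, ← hb1, ← Fin.sum_univ_two (fun i ↦ b.repr _ i • b i), b.sum_repr]⟩
    obtain ⟨t, ht⟩ := IsIntegrallyClosed.isIntegral_iff.mp
      (Algebra.isIntegral_trace (L := ℚ) (R := ℤ) x.isIntegral_coe)
    obtain ⟨n, hn⟩ := IsIntegrallyClosed.isIntegral_iff.mp
      (Algebra.isIntegral_norm ℚ (R := ℤ) x.isIntegral_coe)
    rw [huv, Algebra.trace_quadratic hb0 hb1 hθ'] at ht
    rw [huv, Algebra.norm_quadratic hb0 hb1 hθ'] at hn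
    simp only [eq_intCast] at ht hn
    obtain ⟨w, hw⟩ := Rat.exists_int_of_prime_mul_sq hp (w := 2 * v) (m := 4 * n - t ^ 2) (by
      push_cast
      rw [ht, hn]
      ring)
    have hcong : 4 * n = t ^ 2 + p * w ^ 2 := by
      have : (4 * n : ℚ) = t ^ 2 + p * w ^ 2 := by
        rw [ht, hn, ← hw]
        ring
      exact_mod_cast this
    have hpar : (t - w) % 2 = 0 := by
      have hp' : (p : ℤ) = 4 * c - 1 := by omega
      rcases Int.even_or_odd' t with ⟨t', rfl | rfl⟩ <;>
        rcases Int.even_or_odd' w with ⟨w', rfl | rfl⟩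
      · omega
      · rw [hp'] at hcong
        ring_nf at hcong
        omega
      · rw [hp'] at hcong
        ring_nf at hcong
        omega
      · omega
    obtain ⟨a, ha⟩ := Int.dvd_of_emod_eq_zero hpar
    refine ⟨a, w, ?_⟩
    apply RingOfIntegers.coe_injective
    simp only [map_add, zsmul_eq_mul, map_mul, map_intCast, map_one, hωK, huv]
    have haQ : (a : ℚ) = u - v := by
      have : (2 * a : ℚ) = t - w := by exact_mod_cast ha.symm
      rw [ht, ← hw] at this
      linarith
    have haK : (a : K) = algebraMap ℚ K u - algebraMap ℚ K v := by
      rw [← map_sub, ← haQ]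
      simp
    have hwK : (w : K) = 2 * algebraMap ℚ K v := by
      rw [← map_ofNat (algebraMap ℚ K) 2, ← map_mul, hw]
      simp
    rw [haK, hwK, Algebra.smul_def, Algebra.smul_def]
    ring
  refine ⟨Module.Basis.mk hli hspan, by simp, ?_⟩
  rw [Module.Basis.mk_apply]
  apply RingOfIntegers.coe_injective
  simp [hωK, hw]

theorem NumberField.discr_quadratic {K : Type*} [Field K] [NumberField K]
    {b : Module.Basis (Fin 2) ℤ (𝓞 K)} {s n : ℤ} (h0 : b 0 = 1)
    (h1 : b 1 ^ 2 = s • b 1 - n • (1 : 𝓞 K)) : discr K = s ^ 2 - 4 * n := by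
  rw [← discr_eq_discr K b, Algebra.discr_def, Matrix.det_fin_two]
  simp only [Algebra.traceMatrix_apply, Algebra.traceForm_apply, h0, mul_one, one_mul]
  have t0 := Algebra.trace_quadratic h0 rfl h1 1 0
  have t1 := Algebra.trace_quadratic h0 rfl h1 0 1
  have t2 := Algebra.trace_quadratic h0 rfl h1 (-n) s
  rw [one_smul, zero_smul, add_zero] at t0
  rw [one_smul, zero_smul, zero_add] at t1
  rw [show -n • (1 : 𝓞 K) + s • b 1 = b 1 * b 1 by rw [← sq, h1, neg_smul]; abel] at t2
  rw [t0, t1, t2]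
  ring

namespace NumberField

variable {K : Type*} [Field K] [NumberField K]

theorem nrRealPlaces_eq_zero_of_sq_neg {θ : K} {n : ℕ} (hn : 0 < n) (hθ : θ ^ 2 = -(n : K)) :
    InfinitePlace.nrRealPlaces K = 0 := by
  classical
  rw [InfinitePlace.nrRealPlaces, Fintype.card_eq_zero_iff, isEmpty_subtype]
  intro w hw
  have h := congrArg (InfinitePlace.embedding_of_isReal hw) hθ
  rw [map_pow, map_neg, map_natCast] at h
  have : (0 : ℝ) < n := by exact_mod_cast hn
  nlinarith [sq_nonneg (InfinitePlace.embedding_of_isReal hw θ)]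

theorem regulator_eq_one_of_card_infinitePlace_eq_one
    (h : Fintype.card (InfinitePlace K) = 1) : Units.regulator K = 1 := by
  classical
  obtain ⟨w, hw⟩ := Fintype.card_eq_one_iff.mp h
  have : IsEmpty {w' : InfinitePlace K // w' ≠ w} := ⟨fun w' ↦ w'.2 (hw _)⟩
  have : IsEmpty (Fin (Units.rank K)) := by
    rw [Units.rank, h]
    exact Fin.isEmpty
  rw [Units.regulator_eq_det K w (Equiv.equivOfIsEmpty _ _), Matrix.det_isEmpty, abs_one]

theorem torsionOrder_quadratic {b : Module.Basis (Fin 2) ℤ (𝓞 K)} {c : ℤ} (hc : 2 ≤ c)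
    (h0 : b 0 = 1) (h1 : b 1 ^ 2 = (1 : ℤ) • b 1 - c • (1 : 𝓞 K)) :
    Units.torsionOrder K = 2 := by
  have hunit : ∀ u : (𝓞 K)ˣ, u = 1 ∨ u = -1 := by
    intro u
    have hx : (u : 𝓞 K) = (b.repr u 0) • (1 : 𝓞 K) + (b.repr u 1) • b 1 := by
      rw [← h0, ← Fin.sum_univ_two (fun i ↦ b.repr _ i • b i), b.sum_repr]
    set x := b.repr u 0
    set y := b.repr u 1
    have hn : IsUnit (Algebra.norm ℤ (u : 𝓞 K)) := u.isUnit.map _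
    rw [hx, Algebra.norm_quadratic h0 rfl h1, Int.isUnit_iff] at hn
    have hy : y = 0 := by
      by_contra hy
      have hy1 : 1 ≤ y ^ 2 := by
        have := sq_pos_of_ne_zero hy
        omega
      rcases hn with hn | hn <;> nlinarith [sq_nonneg (2 * x + y)]
    rw [hy] at hx hn
    have hx1 : x ^ 2 = 1 := by
      rcases hn with hn | hn
      · simpa using hn
      · nlinarith [sq_nonneg x]
    rw [zero_smul, add_zero] at hx
    rcases sq_eq_sq_iff_eq_or_eq_neg.mp (hx1.trans (one_pow 2).symm) with h | h
    · exact Or.inl (Units.ext (by rw [hx, h, one_smul, Units.val_one]))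
    · exact Or.inr (Units.ext (by rw [hx, h, neg_smul, one_smul, Units.val_neg, Units.val_one]))
  classical
  let := Fintype.ofFinite (Units.torsion K)
  rw [Units.torsionOrder, Nat.card_eq_fintype_card]
  refine Finset.card_eq_two.2 ⟨1, ⟨-1, (CommGroup.mem_torsion _).mpr
    (isOfFinOrder_iff_pow_eq_one.mpr ⟨2, two_pos, neg_one_sq⟩)⟩,
    by simp [← Subtype.coe_ne_coe], Finset.ext fun x ↦ ⟨fun _ ↦ ?_, fun _ ↦ Finset.mem_univ _⟩⟩
  rw [Finset.mem_insert, Finset.mem_singleton, ← Subtype.val_inj, ← Subtype.val_inj]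
  exact hunit x

open InfinitePlace in
theorem dedekindZeta_residue_of_sq_eq_neg_prime {p : ℕ} (hp : p.Prime) (hp3 : p % 4 = 3)
    (hp7 : 7 ≤ p) (hdeg : Module.finrank ℚ K = 2) {θ : K} (hθ : θ ^ 2 = -(p : K)) :
    dedekindZeta_residue K = Real.pi * classNumber K / √p := by
  obtain ⟨b, h0, h1⟩ := exists_integralBasis_of_sq_eq_neg_prime hp hp3 hdeg hθ
  have hr := nrRealPlaces_eq_zero_of_sq_neg hp.pos hθ
  have hc : nrComplexPlaces K = 1 := by
    have := card_add_two_mul_card_eq_rank K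
    omega
  have hcard : Fintype.card (InfinitePlace K) = 1 := by
    rw [card_eq_nrRealPlaces_add_nrComplexPlaces, hr, hc]
  have hdiscr : discr K = -p := by
    rw [discr_quadratic h0 h1]
    omega
  rw [dedekindZeta_residue_def, hr, hc, regulator_eq_one_of_card_infinitePlace_eq_one hcard,
    torsionOrder_quadratic (by omega) h0 h1, hdiscr]
  push_cast
  rw [abs_neg, Nat.abs_cast, mul_one, pow_zero, one_mul, pow_one, mul_assoc,
    mul_div_mul_left _ _ two_ne_zero]

end NumberField

section IdealCount

open Ideal NumberField

variable {K : Type*} [Field K] [NumberField K]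

theorem Ideal.sup_span_natCast_eq_top {R : Type*} [CommRing R] {m n : ℕ} (h : m.Coprime n) :
    span {(m : R)} ⊔ span {(n : R)} = ⊤ := by
  rw [← isCoprime_iff_sup_eq, isCoprime_span_singleton_iff]
  exact h.cast

theorem Ideal.absNorm_sup_span_natCast_dvd {m n : ℕ} (h : m.Coprime n) {I : Ideal (𝓞 K)}
    (hI : absNorm I ∣ m * n) : absNorm (I ⊔ span {(m : 𝓞 K)}) ∣ m := by
  have h1 : absNorm (I ⊔ span {(m : 𝓞 K)}) ∣ absNorm I := absNorm_dvd_absNorm_of_le le_sup_left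
  have h2 : absNorm (I ⊔ span {(m : 𝓞 K)}) ∣ absNorm (span {(m : 𝓞 K)}) :=
    absNorm_dvd_absNorm_of_le le_sup_right
  rw [absNorm_span_natCast] at h2
  exact ((h.pow_left _).coprime_dvd_left h2).dvd_of_dvd_mul_right (h1.trans hI)

theorem Ideal.sup_span_mul_sup_span_of_absNorm_eq {m n : ℕ} (h : m.Coprime n) {I : Ideal (𝓞 K)}
    (hI : absNorm I = m * n) : (I ⊔ span {(m : 𝓞 K)}) * (I ⊔ span {(n : 𝓞 K)}) = I := by
  refine le_antisymm ?_ ?_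
  · rw [sup_mul, mul_sup, mul_sup]
    refine sup_le (sup_le mul_le_left mul_le_left) (sup_le mul_le_right ?_)
    rw [span_singleton_mul_span_singleton, span_singleton_le_iff_mem, ← Nat.cast_mul, ← hI]
    exact absNorm_mem I
  · calc I = (span {(m : 𝓞 K)} ⊔ span {(n : 𝓞 K)}) * I := by
          rw [sup_span_natCast_eq_top h, top_mul]
      _ ≤ _ := by
          rw [sup_mul]
          refine sup_le (mul_mono le_sup_right le_sup_left) ?_
          rw [mul_comm]
          exact mul_mono le_sup_left le_sup_right

theorem Ideal.mul_sup_span_eq_of_absNorm_eq {m n : ℕ} (h : m.Coprime n) {A B : Ideal (𝓞 K)}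
    (hA : absNorm A = m) (hB : absNorm B = n) : A * B ⊔ span {(m : 𝓞 K)} = A := by
  have hmA : span {(m : 𝓞 K)} ≤ A := by
    rw [span_singleton_le_iff_mem, ← hA]
    exact absNorm_mem A
  have hnB : span {(n : 𝓞 K)} ≤ B := by
    rw [span_singleton_le_iff_mem, ← hB]
    exact absNorm_mem B
  refine le_antisymm (sup_le mul_le_left hmA) ?_
  have htop : B ⊔ span {(m : 𝓞 K)} = ⊤ := by
    rw [eq_top_iff, ← sup_span_natCast_eq_top h, sup_comm]
    exact sup_le_sup hnB le_rfl
  calc A = A * (B ⊔ span {(m : 𝓞 K)}) := by rw [htop, mul_top]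
    _ ≤ _ := by
      rw [mul_sup]
      exact sup_le_sup le_rfl mul_le_right

theorem Ideal.absNorm_sup_span_natCast {m n : ℕ} (h : m.Coprime n) (hm : m ≠ 0) (hn : n ≠ 0)
    {I : Ideal (𝓞 K)} (hI : absNorm I = m * n) : absNorm (I ⊔ span {(m : 𝓞 K)}) = m := by
  have h1 := absNorm_sup_span_natCast_dvd h hI.dvd
  have h2 := absNorm_sup_span_natCast_dvd h.symm (hI.trans (mul_comm _ _)).dvd
  have h3 := congrArg absNorm (sup_span_mul_sup_span_of_absNorm_eq h hI)
  rw [map_mul, hI] at h3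
  refine Nat.le_antisymm (Nat.le_of_dvd (Nat.pos_of_ne_zero hm) h1) ?_
  have h4 := Nat.le_of_dvd (Nat.pos_of_ne_zero hn) h2
  refine Nat.le_of_mul_le_mul_right (c := n) ?_ (Nat.pos_of_ne_zero hn)
  exact h3.symm.le.trans (Nat.mul_le_mul_left _ h4)

variable (K) in
theorem NumberField.card_absNorm_eq_mul {m n : ℕ} (h : m.Coprime n) (hm : m ≠ 0) (hn : n ≠ 0) :
    Nat.card {I : Ideal (𝓞 K) // absNorm I = m * n} =
      Nat.card {I : Ideal (𝓞 K) // absNorm I = m} *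
        Nat.card {I : Ideal (𝓞 K) // absNorm I = n} := by
  rw [← Nat.card_prod]
  refine Nat.card_congr
    { toFun := fun I ↦ (⟨I.1 ⊔ span {(m : 𝓞 K)}, absNorm_sup_span_natCast h hm hn I.2⟩,
        ⟨I.1 ⊔ span {(n : 𝓞 K)},
          absNorm_sup_span_natCast h.symm hn hm (I.2.trans (mul_comm _ _))⟩)
      invFun := fun A ↦ ⟨A.1.1 * A.2.1, by rw [map_mul, A.1.2, A.2.2]⟩
      left_inv := fun I ↦ Subtype.ext (sup_span_mul_sup_span_of_absNorm_eq h I.2)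
      right_inv := fun A ↦ Prod.ext (Subtype.ext (mul_sup_span_eq_of_absNorm_eq h A.1.2 A.2.2))
        (Subtype.ext ?_) }
  simp only
  rw [mul_comm]
  exact mul_sup_span_eq_of_absNorm_eq h.symm A.2.2 A.1.2

end IdealCount

theorem legendreSym_neg_of_mod_four_eq_three {p q : ℕ} [Fact p.Prime] [Fact q.Prime]
    (hp3 : p % 4 = 3) (hq : q ≠ 2) : legendreSym q (-p) = legendreSym p q := by
  have hp2 : p ≠ 2 := by omega
  have hqo : q % 2 = 1 := (Fact.out : q.Prime).eq_two_or_odd.resolve_left hq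
  by_cases hpq : p = q
  · subst hpq
    simp [legendreSym]
  rw [← neg_one_mul, legendreSym.mul, legendreSym.at_neg_one hq, ZMod.χ₄_eq_neg_one_pow hqo,
    legendreSym.quadratic_reciprocity' hp2 hq, ← mul_assoc, pow_mul,
    (Nat.odd_iff.mpr (by omega) : Odd (p / 2)).neg_one_pow, ← mul_pow, neg_one_mul, neg_neg,
    one_pow, one_mul]

/-- The splitting type of a prime `q` in `ℚ(√-p)`, in terms of the roots of
`X ^ 2 - X + (p + 1) / 4` modulo `q`. -/
theorem quadraticChar_trichotomy {p q : ℕ} [Fact p.Prime] (hq : q.Prime) (hp3 : p % 4 = 3)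
    {c : ℤ} (hc : (p : ℤ) + 1 = 4 * c) :
    (quadraticChar (ZMod p) q = -1 ∧ ∀ r : ℤ, ¬ (q : ℤ) ∣ r ^ 2 - r + c) ∨
    (quadraticChar (ZMod p) q = 1 ∧
      ∃ r : ℤ, (q : ℤ) ∣ r ^ 2 - r + c ∧ ¬ (q : ℤ) ∣ 2 * r - 1) ∨
    (quadraticChar (ZMod p) q = 0 ∧
      ∃ r : ℤ, (q : ℤ) ∣ r ^ 2 - r + c ∧ (q : ℤ) ∣ 2 * r - 1) := by
  have : Fact q.Prime := ⟨hq⟩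
  have hpp : p.Prime := Fact.out
  have hdisc : ∀ r : ℤ, 4 * (r ^ 2 - r + c) = (2 * r - 1) ^ 2 + p := fun r ↦ by linarith
  have hqp : ¬ p = q → quadraticChar (ZMod p) q = 1 ∨ quadraticChar (ZMod p) q = -1 := by
    intro h
    refine quadraticChar_dichotomy fun h0 ↦ h ?_
    rw [ZMod.natCast_eq_zero_iff] at h0
    exact (Nat.prime_dvd_prime_iff_eq hpp hq).mp h0
  by_cases hr : ∃ r : ℤ, (q : ℤ) ∣ r ^ 2 - r + c
  · obtain ⟨r, hr⟩ := hr
    refine Or.inr ?_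
    by_cases h2r : (q : ℤ) ∣ 2 * r - 1
    · refine Or.inr ⟨?_, r, hr, h2r⟩
      have : (q : ℤ) ∣ p := by
        have h := hdisc r
        have : (p : ℤ) = 4 * (r ^ 2 - r + c) - (2 * r - 1) ^ 2 := by linarith
        rw [this]
        exact dvd_sub (hr.mul_left _) (h2r.trans (dvd_pow_self _ two_ne_zero))
      rw [(Nat.prime_dvd_prime_iff_eq hq hpp).mp (Int.natCast_dvd_natCast.mp this)]
      simp
    · refine Or.inl ⟨?_, r, hr, h2r⟩
      by_cases hq2 : q = 2
      · subst hq2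
        have hc2 : c % 2 = 0 := by
          have : (r ^ 2 - r) % 2 = 0 := by
            rw [sq, ← mul_sub_one, mul_comm]
            exact Int.emod_eq_zero_of_dvd (Int.even_mul_pred_self r |> fun h ↦ by
              rw [mul_comm]; exact h.two_dvd)
          push_cast at hr
          omega
        rw [quadraticChar_one_iff_isSquare, Nat.cast_two, ZMod.exists_sq_eq_two_iff (by omega)]
        · omega
        · rw [Ne, ZMod.natCast_eq_zero_iff, Nat.prime_dvd_prime_iff_eq hpp hq]
          omega
      · have h := legendreSym_neg_of_mod_four_eq_three (q := q) hp3 hq2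
        rw [legendreSym, legendreSym, Int.cast_natCast] at h
        rw [← h, quadraticChar_one_iff_isSquare]
        · refine ⟨((2 * r - 1 : ℤ) : ZMod q), ?_⟩
          rw [← sq, ← Int.cast_pow, ZMod.intCast_eq_intCast_iff_dvd_sub]
          have : (2 * r - 1) ^ 2 - -(p : ℤ) = 4 * (r ^ 2 - r + c) := by linarith [hdisc r]
          rw [this]
          exact hr.mul_left _
        · rw [Ne, ZMod.intCast_zmod_eq_zero_iff_dvd]
          intro hqp
          refine h2r ((Nat.prime_iff_prime_int.mp hq).dvd_of_dvd_pow (n := 2) ?_)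
          have : (2 * r - 1) ^ 2 = 4 * (r ^ 2 - r + c) + -(p : ℤ) := by linarith [hdisc r]
          rw [this]
          exact dvd_add (hr.mul_left _) hqp
  · push Not at hr
    refine Or.inl ⟨?_, hr⟩
    have hne : ¬ p = q := by
      rintro rfl
      refine hr (2 * c) ?_
      have : (2 * c) ^ 2 - 2 * c + c = c * p := by linear_combination (-c) * hc
      rw [this]
      exact dvd_mul_left _ _
    refine (hqp hne).resolve_left fun h1 ↦ ?_
    by_cases hq2 : q = 2
    · subst hq2
      rw [quadraticChar_one_iff_isSquare, Nat.cast_two, ZMod.exists_sq_eq_two_iff (by omega)] at h1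
      · refine hr 0 ?_
        push_cast
        omega
      · rw [Ne, ZMod.natCast_eq_zero_iff, Nat.prime_dvd_prime_iff_eq hpp hq]
        exact hne
    · have hqo : q % 2 = 1 := hq.eq_two_or_odd.resolve_left hq2
      have h := legendreSym_neg_of_mod_four_eq_three (q := q) hp3 hq2
      rw [legendreSym, legendreSym, Int.cast_natCast, h1, quadraticChar_one_iff_isSquare] at h
      · obtain ⟨y, hy⟩ := h
        obtain ⟨z, rfl⟩ := ZMod.intCast_surjective y
        rw [← Int.cast_mul, ZMod.intCast_eq_intCast_iff_dvd_sub] at hy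
        have hcop : IsCoprime (q : ℤ) 4 := by
          rw [show (4 : ℤ) = ((2 ^ 2 : ℕ) : ℤ) by norm_num, Nat.isCoprime_iff_coprime]
          exact ((Nat.coprime_primes hq Nat.prime_two).mpr hq2).pow_right 2
        set h' : ℤ := (q + 1) / 2
        have hh : 2 * h' = q + 1 := by omega
        refine hr (h' * (1 + z)) (hcop.dvd_of_dvd_mul_left ?_)
        have : 4 * ((h' * (1 + z)) ^ 2 - h' * (1 + z) + c) =
            q * ((q + 2) * (1 + z) ^ 2 - 2 * (1 + z)) + (z * z - -(p : ℤ)) := by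
          linear_combination ((1 + z) ^ 2 * (2 * h' + q + 1) - 2 * (1 + z)) * hh - hc
        rw [this]
        exact dvd_add (dvd_mul_right _ _) hy
      · rw [Ne, ZMod.intCast_zmod_eq_zero_iff_dvd, dvd_neg, Int.natCast_dvd_natCast,
          Nat.prime_dvd_prime_iff_eq hq hpp]
        exact fun h ↦ hne h.symm

section IdealCountPrimePow

open Ideal NumberField

variable {K : Type*} [Field K] [NumberField K] {q : ℕ}

theorem Ideal.mem_closure_of_absNorm_eq_prime_pow (hq : q.Prime) {S : Set (Ideal (𝓞 K))}
    (hS : ∀ Q : Ideal (𝓞 K), Q.IsPrime → (q : 𝓞 K) ∈ Q → Q ∈ S) {k : ℕ} {I : Ideal (𝓞 K)}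
    (hI : absNorm I = q ^ k) : I ∈ Submonoid.closure S := by
  have hI0 : I ≠ 0 := by
    rintro rfl
    rw [Ideal.zero_eq_bot, absNorm_bot] at hI
    exact pow_ne_zero k hq.ne_zero hI.symm
  rw [← associated_iff_eq.mp (UniqueFactorizationMonoid.prod_normalizedFactors hI0)]
  refine Submonoid.multiset_prod_mem _ _ fun Q hQ ↦ Submonoid.subset_closure (hS Q ?_ ?_)
  · exact isPrime_of_prime (UniqueFactorizationMonoid.prime_of_normalized_factor Q hQ)
  · have hQI : I ≤ Q := le_of_dvd (UniqueFactorizationMonoid.dvd_of_mem_normalizedFactors hQ)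
    have hQp := isPrime_of_prime (UniqueFactorizationMonoid.prime_of_normalized_factor Q hQ)
    refine hQp.mem_of_pow_mem k (hQI ?_)
    rw [← Nat.cast_pow, ← hI]
    exact absNorm_mem I

theorem NumberField.card_absNorm_eq_prime_pow_of_unique (hq : q.Prime) {P : Ideal (𝓞 K)} {f : ℕ}
    (hf : 0 < f) (hP : absNorm P = q ^ f)
    (hS : ∀ Q : Ideal (𝓞 K), Q.IsPrime → (q : 𝓞 K) ∈ Q → Q = P) (k : ℕ) :
    Nat.card {I : Ideal (𝓞 K) // absNorm I = q ^ k} = if f ∣ k then 1 else 0 := by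
  have hmem : ∀ {I : Ideal (𝓞 K)}, absNorm I = q ^ k → ∃ j, k = f * j ∧ I = P ^ j := by
    intro I hI
    obtain ⟨j, rfl⟩ := Submonoid.mem_closure_singleton.mp
      (mem_closure_of_absNorm_eq_prime_pow (S := {P}) hq hS hI)
    refine ⟨j, ?_, rfl⟩
    rw [map_pow, hP, ← pow_mul] at hI
    exact (Nat.pow_right_injective hq.two_le hI).symm
  split_ifs with h
  · obtain ⟨j, rfl⟩ := h
    rw [Nat.card_eq_one_iff_exists]
    refine ⟨⟨P ^ j, by rw [map_pow, hP, ← pow_mul]⟩, fun I ↦ Subtype.ext ?_⟩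
    obtain ⟨i, hi, hI⟩ := hmem I.2
    rw [hI, Nat.eq_of_mul_eq_mul_left hf hi]
  · have : IsEmpty {I : Ideal (𝓞 K) // absNorm I = q ^ k} :=
      ⟨fun I ↦ h ((hmem I.2).elim fun j hj ↦ ⟨j, hj.1⟩)⟩
    exact Nat.card_of_isEmpty

theorem NumberField.card_absNorm_eq_prime_pow_of_pair (hq : q.Prime) {P P' : Ideal (𝓞 K)}
    (hP : absNorm P = q) (hP' : absNorm P' = q) (hne : P ≠ P')
    (hS : ∀ Q : Ideal (𝓞 K), Q.IsPrime → (q : 𝓞 K) ∈ Q → Q = P ∨ Q = P') (k : ℕ) :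
    Nat.card {I : Ideal (𝓞 K) // absNorm I = q ^ k} = k + 1 := by
  have hset : {I : Ideal (𝓞 K) | absNorm I = q ^ k} =
      (fun i ↦ P ^ i * P' ^ (k - i)) '' (Finset.range (k + 1) : Set ℕ) := by
    ext I
    simp only [Set.mem_ofPred_eq, Set.mem_image, Finset.coe_range, Set.mem_Iio]
    constructor
    · intro hI
      obtain ⟨i, j, rfl⟩ := (Submonoid.mem_closure_pair _ _ _).mp
        (mem_closure_of_absNorm_eq_prime_pow (S := {P, P'}) hq hS hI)
      rw [map_mul, map_pow, map_pow, hP, hP', ← pow_add] at hI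
      have := Nat.pow_right_injective hq.two_le hI
      exact ⟨i, by omega, by rw [show k - i = j by omega]⟩
    · rintro ⟨i, hi, rfl⟩
      rw [map_mul, map_pow, map_pow, hP, hP', ← pow_add]
      congr 1
      omega
  have hPp : P.IsPrime := isPrime_of_irreducible_absNorm (by rw [hP]; exact hq)
  have hPp' : P'.IsPrime := isPrime_of_irreducible_absNorm (by rw [hP']; exact hq)
  have hP0 : P ≠ ⊥ := by
    rintro rfl
    exact hq.ne_zero (by rw [← hP, absNorm_bot])
  have hP0' : P' ≠ ⊥ := by
    rintro rfl
    exact hq.ne_zero (by rw [← hP', absNorm_bot])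
  have hndvd : ∀ n, ¬ P ∣ P' ^ n := fun n h ↦ by
    have h' := le_of_dvd ((prime_of_isPrime hP0 hPp).dvd_of_dvd_pow h)
    exact hne ((hPp'.isMaximal hP0').eq_of_le hPp.ne_top h').symm
  have hlt : ∀ i j a b : ℕ, i < j → P ^ i * P' ^ a ≠ P ^ j * P' ^ b := by
    intro i j a b hij h
    refine hndvd a ?_
    rw [← Nat.add_sub_of_le hij.le, pow_add, mul_assoc] at h
    have h2 := mul_left_cancel₀ (pow_ne_zero i hP0) h
    rw [h2]
    exact (dvd_pow_self P (by omega)).mul_right _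
  have hinj : Function.Injective fun i ↦ P ^ i * P' ^ (k - i) := by
    intro i j h
    rcases lt_trichotomy i j with hij | hij | hij
    · exact absurd h (hlt _ _ _ _ hij)
    · exact hij
    · exact absurd h.symm (hlt _ _ _ _ hij)
  change Nat.card ({I : Ideal (𝓞 K) | absNorm I = q ^ k} : Set _) = _
  rw [Nat.card_coe_set_eq, hset, Set.ncard_image_of_injective _ hinj, Set.ncard_coe_finset,
    Finset.card_range]

end IdealCountPrimePow

section IdealCountQuadratic

open Ideal NumberField

variable {K : Type*} [Field K] {q : ℕ}
  {b : Module.Basis (Fin 2) ℤ (𝓞 K)} {c : ℤ}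

theorem Ideal.intCast_mem_iff_of_prime_mem {R : Type*} [CommRing R] {Q : Ideal R} (hQ : Q ≠ ⊤)
    (hq : q.Prime) (hqQ : (q : R) ∈ Q) {z : ℤ} : (z : R) ∈ Q ↔ (q : ℤ) ∣ z := by
  constructor
  · intro hz
    by_contra h
    obtain ⟨x, y, hxy⟩ := (Nat.prime_iff_prime_int.mp hq).coprime_iff_not_dvd.mpr h
    refine hQ ((eq_top_iff_one _).mpr ?_)
    have := congrArg (Int.cast : ℤ → R) hxy
    push_cast at this
    rw [← this]
    exact Q.add_mem (Q.mul_mem_left _ hqQ) (Q.mul_mem_left _ hz)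
  · rintro ⟨w, rfl⟩
    push_cast
    exact Q.mul_mem_right _ hqQ

theorem exists_eq_intCast_add_intCast_mul (h0 : b 0 = 1) (x : 𝓞 K) :
    ∃ u v : ℤ, x = u + v * b 1 := by
  refine ⟨b.repr x 0, b.repr x 1, ?_⟩
  conv_lhs => rw [← b.sum_repr x, Fin.sum_univ_two, h0]
  simp

theorem sub_intCast_mul_eq_of_sq (h1 : b 1 ^ 2 = (1 : ℤ) • b 1 - c • (1 : 𝓞 K)) (r : ℤ) :
    (b 1 - (r : 𝓞 K)) * (b 1 - ((1 - r : ℤ) : 𝓞 K)) = ((-(r ^ 2 - r + c) : ℤ) : 𝓞 K) := by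
  rw [one_smul, zsmul_one] at h1
  push_cast
  linear_combination h1

theorem eq_span_of_forall_not_dvd (hq : q.Prime) (h0 : b 0 = 1)
    (h1 : b 1 ^ 2 = (1 : ℤ) • b 1 - c • (1 : 𝓞 K)) (hr : ∀ r : ℤ, ¬ (q : ℤ) ∣ r ^ 2 - r + c)
    {Q : Ideal (𝓞 K)} (hQ : Q.IsPrime) (hqQ : (q : 𝓞 K) ∈ Q) : Q = span {(q : 𝓞 K)} := by
  refine le_antisymm (fun x hx ↦ ?_) ((span_singleton_le_iff_mem Q).mpr hqQ)
  obtain ⟨u, v, rfl⟩ := exists_eq_intCast_add_intCast_mul h0 x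
  have hiff := fun z : ℤ ↦ intCast_mem_iff_of_prime_mem (z := z) hQ.ne_top hq hqQ
  have hv : (q : ℤ) ∣ v := by
    by_contra hv
    obtain ⟨s, t, hst⟩ := (Nat.prime_iff_prime_int.mp hq).coprime_iff_not_dvd.mpr hv
    have hmem : b 1 - ((-(t * u) : ℤ) : 𝓞 K) ∈ Q := by
      have h2 := congrArg (Int.cast : ℤ → 𝓞 K) hst
      push_cast at h2
      have : b 1 - ((-(t * u) : ℤ) : 𝓞 K) = t * (u + v * b 1) + (s * b 1) * q := by
        push_cast
        linear_combination (-b 1) * h2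
      rw [this]
      exact Q.add_mem (Q.mul_mem_left _ hx) (Q.mul_mem_left _ hqQ)
    have h3 := Q.mul_mem_right (b 1 - ((1 - -(t * u) : ℤ) : 𝓞 K)) hmem
    rw [sub_intCast_mul_eq_of_sq h1, hiff, dvd_neg] at h3
    exact hr _ h3
  have hu : (q : ℤ) ∣ u := by
    rw [← hiff]
    have hvQ := Q.mul_mem_right (b 1) ((hiff v).mpr hv)
    exact (Submodule.add_mem_iff_left Q hvQ).mp hx
  rw [mem_span_singleton]
  have hcast : ∀ z : ℤ, (q : ℤ) ∣ z → (q : 𝓞 K) ∣ z := fun z hz ↦ by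
    simpa using Int.cast_dvd_cast (α := 𝓞 K) _ _ hz
  exact dvd_add (hcast u hu) ((hcast v hv).mul_right _)

variable [NumberField K]

theorem absNorm_span_pair_eq (hq : q.Prime) (h0 : b 0 = 1)
    (h1 : b 1 ^ 2 = (1 : ℤ) • b 1 - c • (1 : 𝓞 K)) (hdeg : Module.finrank ℚ K = 2) {r : ℤ}
    (hr : (q : ℤ) ∣ r ^ 2 - r + c) : absNorm (span {(q : 𝓞 K), b 1 - (r : 𝓞 K)}) = q := by
  have hle : ∀ r : ℤ, absNorm (span {(q : 𝓞 K), b 1 - (r : 𝓞 K)}) ≤ q := by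
    intro r
    set P := span {(q : 𝓞 K), b 1 - (r : 𝓞 K)} with hP
    have hqP : (q : 𝓞 K) ∈ P := subset_span (by simp)
    have hrP : b 1 - (r : 𝓞 K) ∈ P := subset_span (by simp)
    have : NeZero q := ⟨hq.ne_zero⟩
    have hsurj : Function.Surjective fun i : Fin q ↦ Ideal.Quotient.mk P (i.val : 𝓞 K) := by
      intro y
      obtain ⟨x, rfl⟩ := Ideal.Quotient.mk_surjective y
      obtain ⟨u, v, rfl⟩ := exists_eq_intCast_add_intCast_mul h0 x
      have hq0 : (0 : ℤ) < q := by exact_mod_cast hq.pos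
      obtain ⟨n, hn⟩ := Int.eq_ofNat_of_zero_le (Int.emod_nonneg (u + v * r) hq0.ne')
      have hnq : n < q := by
        have := Int.emod_lt_of_pos (u + v * r) hq0
        omega
      refine ⟨⟨n, hnq⟩, ?_⟩
      rw [Ideal.Quotient.eq]
      have h2 := congrArg (Int.cast : ℤ → 𝓞 K) (Int.emod_add_mul_ediv (u + v * r) q)
      rw [hn] at h2
      push_cast at h2
      have : (n : 𝓞 K) - (u + v * b 1) =
          (-(((u + v * r) / q : ℤ) : 𝓞 K)) * q + (-(v : 𝓞 K)) * (b 1 - r) := by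
        linear_combination h2
      simp only
      rw [this]
      exact P.add_mem (P.mul_mem_left _ hqP) (P.mul_mem_left _ hrP)
    have := Nat.card_le_card_of_surjective _ hsurj
    rwa [Nat.card_fin] at this
  have hmul : span {(q : 𝓞 K), b 1 - (r : 𝓞 K)} * span {(q : 𝓞 K), b 1 - ((1 - r : ℤ) : 𝓞 K)} ≤
      span {(q : 𝓞 K)} := by
    rw [span_mul_span', span_le]
    rintro _ ⟨x, hx, y, hy, rfl⟩
    simp only [Set.mem_insert_iff, Set.mem_singleton_iff] at hx hy
    simp only [SetLike.mem_coe, mem_span_singleton]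
    rcases hx with rfl | rfl
    · exact dvd_mul_right _ _
    rcases hy with rfl | rfl
    · exact dvd_mul_left _ _
    rw [sub_intCast_mul_eq_of_sq h1]
    simpa using Int.cast_dvd_cast (α := 𝓞 K) _ _ (dvd_neg.mpr hr)
  have hdvd := absNorm_dvd_absNorm_of_le hmul
  rw [map_mul, absNorm_span_natCast, RingOfIntegers.rank, hdeg] at hdvd
  have hqq : q * q ≤ absNorm (span {(q : 𝓞 K), b 1 - (r : 𝓞 K)}) * q := by
    rw [← sq]
    refine (Nat.le_of_dvd ?_ hdvd).trans (Nat.mul_le_mul_left _ (hle _))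
    refine Nat.pos_of_ne_zero (mul_ne_zero ?_ ?_) <;>
    · rw [Ne, absNorm_eq_zero_iff, span_eq_bot]
      intro h
      have := h (q : 𝓞 K) (by simp)
      exact hq.ne_zero (by exact_mod_cast this)
  exact le_antisymm (hle r) (Nat.le_of_mul_le_mul_right hqq hq.pos)

end IdealCountQuadratic

section IdealCountCharacter

open Ideal NumberField

variable {K : Type*} [Field K] [NumberField K] {p q : ℕ} [Fact p.Prime]
  {b : Module.Basis (Fin 2) ℤ (𝓞 K)} {c : ℤ}

theorem eq_span_pair_or_eq_span_pair (hq : q.Prime) (h0 : b 0 = 1)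
    (h1 : b 1 ^ 2 = (1 : ℤ) • b 1 - c • (1 : 𝓞 K)) (hdeg : Module.finrank ℚ K = 2) {r : ℤ}
    (hr : (q : ℤ) ∣ r ^ 2 - r + c) {Q : Ideal (𝓞 K)} (hQ : Q.IsPrime) (hqQ : (q : 𝓞 K) ∈ Q) :
    Q = span {(q : 𝓞 K), b 1 - (r : 𝓞 K)} ∨
      Q = span {(q : 𝓞 K), b 1 - ((1 - r : ℤ) : 𝓞 K)} := by
  have hmax : ∀ s : ℤ, (q : ℤ) ∣ s ^ 2 - s + c → b 1 - (s : 𝓞 K) ∈ Q →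
      Q = span {(q : 𝓞 K), b 1 - (s : 𝓞 K)} := by
    intro s hs hsQ
    have hN := absNorm_span_pair_eq hq h0 h1 hdeg hs
    have hprime := isPrime_of_irreducible_absNorm (hN.symm ▸ hq)
    have hbot : span {(q : 𝓞 K), b 1 - (s : 𝓞 K)} ≠ ⊥ := by
      intro h
      rw [h, absNorm_bot] at hN
      exact hq.ne_zero hN.symm
    refine ((hprime.isMaximal hbot).eq_of_le hQ.ne_top (span_le.mpr ?_)).symm
    rintro x (rfl | rfl)
    exacts [hqQ, hsQ]
  have hmem : (b 1 - (r : 𝓞 K)) * (b 1 - ((1 - r : ℤ) : 𝓞 K)) ∈ Q := by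
    rw [sub_intCast_mul_eq_of_sq h1, intCast_mem_iff_of_prime_mem hQ.ne_top hq hqQ]
    exact dvd_neg.mpr hr
  refine (hQ.mem_or_mem hmem).imp (hmax r hr) (hmax (1 - r) ?_)
  rwa [show (1 - r) ^ 2 - (1 - r) + c = r ^ 2 - r + c by ring]

theorem NumberField.card_absNorm_eq_prime_pow_eq_sum (hq : q.Prime) (hp3 : p % 4 = 3)
    (hc : (p : ℤ) + 1 = 4 * c) (h0 : b 0 = 1) (h1 : b 1 ^ 2 = (1 : ℤ) • b 1 - c • (1 : 𝓞 K))
    (hdeg : Module.finrank ℚ K = 2) (k : ℕ) :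
    (Nat.card {I : Ideal (𝓞 K) // absNorm I = q ^ k} : ℤ) =
      ∑ j ∈ Finset.range (k + 1), quadraticChar (ZMod p) q ^ j := by
  have hsub : ∀ r : ℤ, (b 1 - (r : 𝓞 K)) - (b 1 - ((1 - r : ℤ) : 𝓞 K)) =
      ((-(2 * r - 1) : ℤ) : 𝓞 K) := fun r ↦ by push_cast; ring
  rcases quadraticChar_trichotomy hq hp3 hc with ⟨hχ, hr⟩ | ⟨hχ, r, hr, h2⟩ | ⟨hχ, r, hr, h2⟩
  · have hN : absNorm (span {(q : 𝓞 K)}) = q ^ 2 := by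
      rw [absNorm_span_natCast, RingOfIntegers.rank, hdeg]
    rw [card_absNorm_eq_prime_pow_of_unique hq two_pos hN
      (fun Q hQ hqQ ↦ eq_span_of_forall_not_dvd hq h0 h1 hr hQ hqQ), hχ, neg_one_geom_sum]
    rcases k.even_or_odd with hk | hk
    · simp [← even_iff_two_dvd, hk, Nat.even_add_one]
    · simp [← even_iff_two_dvd, hk, Nat.not_even_iff_odd.mpr hk]
  · have hr' : (q : ℤ) ∣ (1 - r) ^ 2 - (1 - r) + c := by
      rwa [show (1 - r) ^ 2 - (1 - r) + c = r ^ 2 - r + c by ring]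
    have hN := absNorm_span_pair_eq hq h0 h1 hdeg hr
    rw [card_absNorm_eq_prime_pow_of_pair hq hN (absNorm_span_pair_eq hq h0 h1 hdeg hr')
      ?_ (fun Q hQ hqQ ↦ eq_span_pair_or_eq_span_pair hq h0 h1 hdeg hr hQ hqQ), hχ]
    · simp
    intro heq
    have htop : span {(q : 𝓞 K), b 1 - (r : 𝓞 K)} ≠ ⊤ := by
      intro h
      rw [h, absNorm_top] at hN
      exact hq.one_lt.ne hN
    have hmem := Submodule.sub_mem (span {(q : 𝓞 K), b 1 - (r : 𝓞 K)})
      (subset_span (by simp) : b 1 - (r : 𝓞 K) ∈ _)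
      (heq ▸ subset_span (by simp) : b 1 - ((1 - r : ℤ) : 𝓞 K) ∈ _)
    rw [hsub, intCast_mem_iff_of_prime_mem htop hq (subset_span (by simp)), dvd_neg] at hmem
    exact h2 hmem
  · have heq : span {(q : 𝓞 K), b 1 - ((1 - r : ℤ) : 𝓞 K)} =
        span {(q : 𝓞 K), b 1 - (r : 𝓞 K)} := by
      obtain ⟨m, hm⟩ := h2
      have : b 1 - ((1 - r : ℤ) : 𝓞 K) = (b 1 - (r : 𝓞 K)) + (m : 𝓞 K) * q := by
        have := hsub r
        rw [hm] at this
        push_cast at this ⊢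
        linear_combination -this
      rw [this, span_pair_add_mul_left]
    rw [card_absNorm_eq_prime_pow_of_unique hq one_pos
      (by rw [pow_one]; exact absNorm_span_pair_eq hq h0 h1 hdeg hr)
      (fun Q hQ hqQ ↦ (eq_span_pair_or_eq_span_pair hq h0 h1 hdeg hr hQ hqQ).elim id
        fun h ↦ h.trans heq), hχ, Finset.sum_range_succ']
    simp

end IdealCountCharacter

section ClassNumberFormula

open Ideal NumberField Filter Topology

variable {K : Type*} [Field K] [NumberField K] {p : ℕ} [Fact p.Prime]

theorem NumberField.isMultiplicative_card_absNorm_eq (K : Type*) [Field K] [NumberField K] :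
    (toArithmeticFunction fun n ↦
      (Nat.card {I : Ideal (𝓞 K) // absNorm I = n} : ℂ)).IsMultiplicative := by
  rw [ArithmeticFunction.IsMultiplicative.iff_ne_zero]
  refine ⟨?_, fun {m n} hm hn h ↦ ?_⟩
  · simp [toArithmeticFunction, absNorm_eq_one_iff]
  · simp [toArithmeticFunction, hm, hn, card_absNorm_eq_mul K h hm hn]

theorem NumberField.toArithmeticFunction_card_absNorm_eq_zetaMul (hp3 : p % 4 = 3)
    (hdeg : Module.finrank ℚ K = 2) {θ : K} (hθ : θ ^ 2 = -(p : K)) :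
    (toArithmeticFunction fun n ↦ (Nat.card {I : Ideal (𝓞 K) // absNorm I = n} : ℂ)) =
      (quadraticDirichletCharacter p).zetaMul := by
  rw [(isMultiplicative_card_absNorm_eq K).eq_iff_eq_on_prime_powers _ _
    (DirichletCharacter.isMultiplicative_zetaMul _)]
  intro q k hq
  obtain ⟨b, h0, h1⟩ := exists_integralBasis_of_sq_eq_neg_prime Fact.out hp3 hdeg hθ
  have h := congrArg (Int.cast : ℤ → ℂ)
    (card_absNorm_eq_prime_pow_eq_sum hq hp3 (by omega) h0 h1 hdeg k)
  push_cast at h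
  rw [DirichletCharacter.zetaMul, ArithmeticFunction.coe_zeta_mul_apply,
    Nat.sum_divisors_prime_pow hq]
  simp only [toArithmeticFunction, ArithmeticFunction.coe_mk, pow_eq_zero_iff', hq.ne_zero,
    false_and, if_false, h, Nat.cast_pow, map_pow, quadraticDirichletCharacter_apply,
    Int.cast_pow]

theorem NumberField.dedekindZeta_eq_riemannZeta_mul_LSeries (hp3 : p % 4 = 3)
    (hdeg : Module.finrank ℚ K = 2) {θ : K} (hθ : θ ^ 2 = -(p : K)) {s : ℂ} (hs : 1 < s.re) :
    dedekindZeta K s = riemannZeta s * LSeries (quadraticDirichletCharacter p ·) s := by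
  have hcongr : dedekindZeta K s = LSeries (quadraticDirichletCharacter p).zetaMul s := by
    rw [← toArithmeticFunction_card_absNorm_eq_zetaMul hp3 hdeg hθ]
    exact LSeries_congr (fun {n} hn ↦ by simp [toArithmeticFunction, hn]) s
  rw [hcongr, DirichletCharacter.zetaMul, ← ArithmeticFunction.coe_mul, LSeries_convolution']
  · congr 1
    · simp_rw [← ArithmeticFunction.LSeries_zeta_eq_riemannZeta hs,
        ← ArithmeticFunction.natCoe_apply]
    · exact (LSeries_congr
        (quadraticDirichletCharacter p).apply_eq_toArithmeticFunction_apply s).symm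
  · exact ArithmeticFunction.LSeriesSummable_zeta_iff.mpr hs
  · exact (LSeriesSummable_congr _ fun h ↦
      ((quadraticDirichletCharacter p).apply_eq_toArithmeticFunction_apply h).symm).mpr <|
        ZMod.LSeriesSummable_of_one_lt_re _ hs

/-- Dirichlet's class number formula for `ℚ(√-p)` in finite form. -/
theorem NumberField.prime_mul_classNumber_eq (hp3 : p % 4 = 3) (hp7 : 7 ≤ p)
    (hdeg : Module.finrank ℚ K = 2) {θ : K} (hθ : θ ^ 2 = -(p : K)) :
    (p : ℤ) * classNumber K = -∑ a : ZMod p, quadraticChar (ZMod p) a * (a.val : ℤ) := by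
  have hζ : Tendsto (fun s : ℝ ↦ ((s : ℂ) - 1) * riemannZeta s) (𝓝[>] 1) (𝓝 1) := by
    refine riemannZeta_residue_one.comp (tendsto_nhdsWithin_iff.mpr ⟨?_, ?_⟩)
    · exact (Complex.continuous_ofReal.tendsto' 1 1 Complex.ofReal_one).mono_left
        nhdsWithin_le_nhds
    · filter_upwards [self_mem_nhdsWithin] with s hs
      exact Complex.ofReal_ne_one.mpr (ne_of_gt hs)
  have hlim := hζ.mul (tendsto_LSeries_quadraticDirichletCharacter hp3)
  rw [one_mul] at hlim
  have heq := tendsto_nhds_unique (tendsto_sub_one_mul_dedekindZeta_nhdsGT K)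
    (hlim.congr' (by
      filter_upwards [self_mem_nhdsWithin] with s hs
      rw [dedekindZeta_eq_riemannZeta_mul_LSeries hp3 hdeg hθ (by simpa using hs), mul_assoc]))
  rw [Complex.ofReal_inj,
    dedekindZeta_residue_of_sq_eq_neg_prime Fact.out hp3 hp7 hdeg hθ] at heq
  have hp0 : (0 : ℝ) < p := by exact_mod_cast (by omega : 0 < p)
  have hsqrt := Real.sqrt_pos.mpr hp0
  have hpi := Real.pi_pos
  field_simp at heq
  have : ((p : ℤ) * classNumber K : ℝ) =
      ((-∑ a : ZMod p, quadraticChar (ZMod p) a * (a.val : ℤ) : ℤ) : ℝ) := by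
    push_cast at heq ⊢
    linarith
  exact_mod_cast this

end ClassNumberFormula

/-- Girstmair's formula: let `p ≡ 3 (mod 4)` be a prime, `p ≥ 7`, and `ℓ ≥ 2`
a primitive root mod `p`. Write `1/p = Σ_{n ≥ 1} x_n / ℓ^n` with digits
`x_n ∈ {0, …, ℓ−1}`, purely periodic with period `p − 1`. If `K = ℚ(√−p)`,
then `Σ_{n=1}^{p−1} (−1)^n x_n = (ℓ + 1)·h(−p)`. -/
theorem girstmair_formula (p : ℕ) [Fact p.Prime] (hp7 : 7 ≤ p)
    (hp3 : p % 4 = 3) (ℓ : ℕ) (hℓ : 2 ≤ ℓ)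
    (hprim : orderOf ((ℓ : ZMod p)) = p - 1)
    (x : ℕ → ℕ) (hdig : ∀ n, x n < ℓ)
    (hexp : (1 : ℝ) / p = ∑' n : ℕ, (x (n + 1) : ℝ) / (ℓ : ℝ) ^ (n + 1))
    (hper : ∀ n, 1 ≤ n → x (n + (p - 1)) = x n)
    (K : Type*) [Field K] [NumberField K]
    (hdeg : Module.finrank ℚ K = 2)
    (hK : ∃ θ : K, θ ^ 2 = -(p : K)) :
    ∑ n ∈ Finset.Icc 1 (p - 1), (-1 : ℤ) ^ n * (x n : ℤ) =
      (ℓ + 1) * (NumberField.classNumber K : ℤ) := by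
  obtain ⟨θ, hθ⟩ := hK
  have hsum := sum_alternating_digits (by omega) hℓ hprim hdig hexp
  have hh := NumberField.prime_mul_classNumber_eq hp3 hp7 hdeg hθ
  refine mul_left_cancel₀ (b := ∑ n ∈ Finset.Icc 1 (p - 1), (-1 : ℤ) ^ n * (x n : ℤ))
    (by omega : (p : ℤ) ≠ 0) ?_
  linear_combination hsum - (ℓ + 1) * hh
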